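/- Let Q be a finitely generated nilpotent group of nilpotency class 2. Then there exists a finitely presented group G and an abelian normal subgroup A of G such that A contains every nilpotent normal subgroup of G (so A is the Fitting subgroup of G, and this Fitting subgroup is abelian) and the quotient group G/A is isomorphic to Q. -/

import Mathlib

/-- A group is finitely presented if it is isomorphic to the quotient of a finitely
generated free group by the normal closure of a finite set of relators; equivalently,
to a `PresentedGroup` on finitely many generators with finitely many relations. -/
def IsFinitelyPresented (G : Type*) [Group G] : Prop :=
  ∃ (n : ℕ) (rels : Set (FreeGroup (Fin n))),
    rels.Finite ∧ Nonempty (G ≃* PresentedGroup rels)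

open scoped commutatorElement



theorem fq_ker_fng {F H : Type*} [Group F] [Group H] [hF : Group.FG F]
    [hH : Group.IsFinitelyPresented H] (f : F →* H) (hf : Function.Surjective f) :
    f.ker.IsFinitelyNormallyGenerated := by
  obtain ⟨n, φ, hφ, S, hS, hSφ⟩ := hH.out
  obtain ⟨T, hT, hTfin⟩ := Group.fg_iff.mp hF
  choose sec hsec using hf
  choose u hu using hφ
  set ψ : FreeGroup (Fin n) →* F := FreeGroup.lift (fun i => sec (φ (FreeGroup.of i))) with hψ
  have hcomp : ∀ v, f (ψ v) = φ v := by
    intro v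
    have : f.comp ψ = φ := by
      ext i
      simp [hψ, hsec]
    exact DFunLike.congr_fun this v
  set R : Set F := (ψ '' S) ∪ ((fun t => t⁻¹ * ψ (u (f t))) '' T) with hR
  refine ⟨R, (hS.image _).union (hTfin.image _), le_antisymm ?_ ?_⟩
  · apply Subgroup.normalClosure_le_normal
    rintro x (⟨s, hs, rfl⟩ | ⟨t, ht, rfl⟩)
    · have : s ∈ φ.ker := hSφ ▸ Subgroup.subset_normalClosure hs
      simpa [MonoidHom.mem_ker, hcomp] using this
    · simp [MonoidHom.mem_ker, hcomp, hu]
  · set K := Subgroup.normalClosure R with hK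
    have h1 : ∀ v ∈ φ.ker, ψ v ∈ K := by
      have : φ.ker ≤ K.comap ψ := by
        rw [← hSφ]
        apply Subgroup.normalClosure_le_normal
        intro s hs
        exact Subgroup.subset_normalClosure (Or.inl ⟨s, hs, rfl⟩)
      exact this
    have h2 : ∀ g : F, ∃ v, g⁻¹ * ψ v ∈ K := by
      intro g
      have hg : g ∈ Subgroup.closure T := hT ▸ Subgroup.mem_top g
      induction hg using Subgroup.closure_induction with
      | mem t ht => exact ⟨u (f t), Subgroup.subset_normalClosure (Or.inr ⟨t, ht, rfl⟩)⟩
      | one => exact ⟨1, by simp⟩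
      | mul a b _ _ ha hb =>
        obtain ⟨v, hv⟩ := ha
        obtain ⟨v', hv'⟩ := hb
        refine ⟨v * v', ?_⟩
        have h3 := Subgroup.Normal.conj_mem (Subgroup.normalClosure_normal (s := R)) _ hv b⁻¹
        have := K.mul_mem h3 hv'
        convert this using 1
        simp [mul_assoc]
      | inv a _ ha =>
        obtain ⟨v, hv⟩ := ha
        refine ⟨v⁻¹, ?_⟩
        have h3 := Subgroup.Normal.conj_mem (Subgroup.normalClosure_normal (s := R)) _
          (K.inv_mem hv) a
        convert h3 using 1
        simp [mul_assoc]
    intro g hg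
    obtain ⟨v, hv⟩ := h2 g
    have hv2 : φ v = 1 := by
      have : g⁻¹ * ψ v ∈ f.ker := by
        have hle : K ≤ f.ker := by
          apply Subgroup.normalClosure_le_normal
          rintro x (⟨s, hs, rfl⟩ | ⟨t, ht, rfl⟩)
          · have : s ∈ φ.ker := hSφ ▸ Subgroup.subset_normalClosure hs
            simpa [MonoidHom.mem_ker, hcomp] using this
          · simp [MonoidHom.mem_ker, hcomp, hu]
        exact hle hv
      rw [MonoidHom.mem_ker, map_mul, hcomp, map_inv, MonoidHom.mem_ker.mp hg] at this
      simpa using this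
    have h4 := h1 v hv2
    have := K.mul_mem h4 (K.inv_mem hv)
    simpa using this

theorem fq_sub_fg {A : Type*} [CommGroup A] (hA : Group.FG A) (H : Subgroup A) : H.FG := by
  rw [Subgroup.fg_iff_add_fg]
  have h1 : AddGroup.FG (Additive A) := inferInstance
  have h2 : Module.Finite ℤ (Additive A) := Module.Finite.iff_addGroup_fg.mpr h1
  have h3 : IsNoetherian ℤ (Additive A) := inferInstance
  have h4 := h3.noetherian (AddSubgroup.toIntSubmodule H.toAddSubgroup)
  have := (Submodule.fg_iff_addSubgroup_fg _).mp h4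
  simpa using this

theorem fq_fp_of_center {Q : Type*} [Group Q] (hQ : Group.FG Q)
    (h : Group.IsFinitelyPresented (Q ⧸ Subgroup.center Q)) : Group.IsFinitelyPresented Q := by
  obtain ⟨n, hn, f, hf⟩ := Group.fg_iff_exists_freeGroup_hom_surjective_finite.mp hQ
  set q := (QuotientGroup.mk' (Subgroup.center Q)).comp f with hq
  have hqs : Function.Surjective q := (QuotientGroup.mk'_surjective _).comp hf
  obtain ⟨S, hS, hSq⟩ := fq_ker_fng q hqs
  set R : Set (FreeGroup n) := (fun p : FreeGroup n × n => ⁅p.1, FreeGroup.of p.2⁆) ''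
    (S ×ˢ Set.univ) with hR
  have hRfin : R.Finite := (hS.prod Set.finite_univ).image _
  set N := Subgroup.normalClosure R with hN
  have hfp1 : Group.IsFinitelyPresented (FreeGroup n ⧸ N) :=
    Group.IsFinitelyPresented.quotient N ⟨R, hRfin, rfl⟩
  have hSc : ∀ p ∈ S, f p ∈ Subgroup.center Q := by
    intro p hp
    have : p ∈ q.ker := hSq ▸ Subgroup.subset_normalClosure hp
    simpa [hq, MonoidHom.mem_ker] using this
  have hNf : N ≤ f.ker := by
    apply Subgroup.normalClosure_le_normal
    rintro _ ⟨⟨p, j⟩, ⟨hp, -⟩, rfl⟩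
    have := Subgroup.mem_center_iff.mp (hSc p hp) (f (FreeGroup.of j))
    simp only [SetLike.mem_coe, MonoidHom.mem_ker, map_commutatorElement]
    rw [commutatorElement_eq_one_iff_mul_comm]
    exact this.symm
  set f1 : FreeGroup n ⧸ N →* Q := QuotientGroup.lift N f hNf with hf1
  have hf1s : Function.Surjective f1 := by
    intro y
    obtain ⟨x, rfl⟩ := hf y
    exact ⟨QuotientGroup.mk x, rfl⟩
  set S1 : Set (FreeGroup n ⧸ N) := (QuotientGroup.mk' N) '' S with hS1
  have hcen : S1 ⊆ Subgroup.center (FreeGroup n ⧸ N) := by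
    rintro _ ⟨p, hp, rfl⟩
    rw [SetLike.mem_coe, Subgroup.mem_center_iff]
    intro g
    obtain ⟨g, rfl⟩ := QuotientGroup.mk'_surjective N g
    have : g ∈ Subgroup.closure (Set.range (FreeGroup.of : n → FreeGroup n)) := by
      rw [FreeGroup.closure_range_of]; trivial
    have hle : Subgroup.closure (Set.range (FreeGroup.of : n → FreeGroup n)) ≤
        (Subgroup.centralizer {QuotientGroup.mk' N p}).comap (QuotientGroup.mk' N) := by
      rw [Subgroup.closure_le]
      rintro _ ⟨j, rfl⟩
      simp only [SetLike.mem_coe, Subgroup.mem_comap, Subgroup.mem_centralizer_singleton_iff]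
      have h1 : ⁅p, FreeGroup.of j⁆ ∈ N :=
        Subgroup.subset_normalClosure ⟨(p, j), ⟨hp, trivial⟩, rfl⟩
      have h2 : QuotientGroup.mk' N ⁅p, FreeGroup.of j⁆ = 1 :=
        (QuotientGroup.eq_one_iff _).mpr h1
      rw [map_commutatorElement, commutatorElement_eq_one_iff_mul_comm] at h2
      exact h2.symm
    have h3 := hle this
    simpa only [SetLike.mem_coe, Subgroup.mem_comap, Subgroup.mem_centralizer_singleton_iff]
      using h3
  have hclle : Subgroup.closure S1 ≤ Subgroup.center (FreeGroup n ⧸ N) := by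
    rwa [Subgroup.closure_le]
  have hker : f1.ker ≤ Subgroup.closure S1 := by
    have hnorm : (Subgroup.closure S1).Normal := by
      constructor
      intro x hx g
      have := Subgroup.mem_center_iff.mp (hclle hx) g
      rw [this]
      simpa using hx
    intro x hx
    obtain ⟨x, rfl⟩ := QuotientGroup.mk'_surjective N x
    have hx' : f x = 1 := hx
    have : x ∈ q.ker := by simp [hq, MonoidHom.mem_ker, hx']
    rw [← hSq] at this
    have hle : Subgroup.normalClosure S ≤ (Subgroup.closure S1).comap (QuotientGroup.mk' N) := by
      apply Subgroup.normalClosure_le_normal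
      intro s hs
      exact Subgroup.subset_closure ⟨s, hs, rfl⟩
    exact hle this
  have hS1fin : S1.Finite := hS.image _
  have : Finite S1 := hS1fin
  let _ : CommGroup (Subgroup.closure S1) :=
    { (inferInstance : Group (Subgroup.closure S1)) with
      mul_comm := fun a b => Subtype.ext (Subgroup.mem_center_iff.mp (hclle b.2) a) }
  have hfgC : Group.FG (Subgroup.closure S1) := inferInstance
  have h1 := fq_sub_fg hfgC (f1.ker.subgroupOf (Subgroup.closure S1))
  have h2 : f1.ker.FG := by
    have h3 : (f1.ker.subgroupOf (Subgroup.closure S1)).map (Subgroup.closure S1).subtype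
        = f1.ker := by
      rw [Subgroup.subgroupOf_map_subtype]
      exact inf_eq_left.mpr hker
    obtain ⟨T, hT⟩ := h1
    rw [← h3, Subgroup.fg_iff]
    refine ⟨(Subgroup.closure S1).subtype '' T, ?_, T.finite_toSet.image _⟩
    rw [← MonoidHom.map_closure, hT]
  have h3 : Group.FG f1.ker := (Group.fg_iff_subgroup_fg _).mpr h2
  exact Group.IsFinitelyPresented.of_surjective f1 hf1s (Subgroup.IsFinitelyNormallyGenerated.of_FG _)

theorem fq_fp_class_two {Q : Type*} [Group Q] (hQ : Group.FG Q)
    (h2 : ∀ p q : Q, ⁅p, q⁆ ∈ Subgroup.center Q) : Group.IsFinitelyPresented Q := by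
  apply fq_fp_of_center hQ
  have hcomm : ∀ a b : Q ⧸ Subgroup.center Q, a * b = b * a := by
    intro a b
    obtain ⟨a, rfl⟩ := QuotientGroup.mk'_surjective _ a
    obtain ⟨b, rfl⟩ := QuotientGroup.mk'_surjective _ b
    rw [← commutatorElement_eq_one_iff_mul_comm, ← map_commutatorElement]
    exact (QuotientGroup.eq_one_iff _).mpr (h2 a b)
  apply fq_fp_of_center inferInstance
  have : Subgroup.center (Q ⧸ Subgroup.center Q) = ⊤ := by
    rw [eq_top_iff]
    intro x _
    rw [Subgroup.mem_center_iff]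
    exact fun g => hcomm g x
  have : Subsingleton ((Q ⧸ Subgroup.center Q) ⧸ Subgroup.center (Q ⧸ Subgroup.center Q)) := by
    rw [this]
    exact QuotientGroup.subsingleton_quotient_top
  infer_instance


structure FqRels {Q I G : Type} [Group Q] [Group G] (ι : Q →* G) (a : I → G)
    (St : I → Set Q) (Pr : I → Set (Q × Q)) (w : Q) (e : I → ℕ) (B : Set Q) : Prop where
  st : ∀ k, ∀ s ∈ St k, ι s * a k * (ι s)⁻¹ = a k
  ww : ∀ k, ι w * a k * (ι w)⁻¹ = a k ^ e k
  pr : ∀ k, ∀ p ∈ Pr k, ι p.2 * a k * (ι p.2)⁻¹ = a k * (ι p.1 * a k * (ι p.1)⁻¹)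
  cm : ∀ k l, ∀ q ∈ B, Commute (a k) (ι q * a l * (ι q)⁻¹)

theorem fq_exists_quot {Q I F : Type} [Group Q] [Group F] [Finite I]
    (hF : Group.IsFinitelyPresented F) (j : Q →* F) (α : I → F)
    (hgen : ∀ x, x ∈ Subgroup.closure (Set.range j ∪ Set.range α))
    (huni : ∀ (H : Type) [Group H] (ι' : Q →* H) (a' : I → H),
      ∃ Φ : F →* H, (∀ q, Φ (j q) = ι' q) ∧ (∀ k, Φ (α k) = a' k))
    (St : I → Set Q) (Pr : I → Set (Q × Q)) (w : Q) (e : I → ℕ) (B : Set Q)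
    (hSt : ∀ k, (St k).Finite) (hPr : ∀ k, (Pr k).Finite) (hB : B.Finite) :
    ∃ (G : Type) (_ : Group G) (ι : Q →* G) (a : I → G),
      Group.IsFinitelyPresented G ∧ FqRels ι a St Pr w e B ∧
      Subgroup.closure (Set.range ι ∪ Set.range a) = ⊤ ∧
      ∀ (H : Type) [Group H] (ι' : Q →* H) (a' : I → H), FqRels ι' a' St Pr w e B →
        ∃ ψ : G →* H, (∀ q, ψ (ι q) = ι' q) ∧ (∀ k, ψ (a k) = a' k) := by
  classical
  let R1 : Set F := ⋃ k, (fun s => j s * α k * (j s)⁻¹ * (α k)⁻¹) '' St k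
  let R2 : Set F := Set.range (fun k => j w * α k * (j w)⁻¹ * (α k ^ e k)⁻¹)
  let R3 : Set F := ⋃ k, (fun p : Q × Q => j p.2 * α k * (j p.2)⁻¹ *
    (α k * (j p.1 * α k * (j p.1)⁻¹))⁻¹) '' Pr k
  let R4 : Set F := ⋃ k, ⋃ l, (fun q => α k * (j q * α l * (j q)⁻¹) *
    ((j q * α l * (j q)⁻¹) * α k)⁻¹) '' B
  let R : Set F := R1 ∪ R2 ∪ R3 ∪ R4
  have hR : R.Finite := by
    refine ((Set.Finite.union ?_ (Set.finite_range _)).union ?_).union ?_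
    · exact Set.finite_iUnion fun k => (hSt k).image _
    · exact Set.finite_iUnion fun k => (hPr k).image _
    · exact Set.finite_iUnion fun k => Set.finite_iUnion fun l => hB.image _
  let N := Subgroup.normalClosure R
  let mk : F →* F ⧸ N := QuotientGroup.mk' N
  have hmk : ∀ x y : F, x * y⁻¹ ∈ R → mk x = mk y := by
    intro x y h
    have : mk (x * y⁻¹) = 1 :=
      (QuotientGroup.eq_one_iff _).mpr (Subgroup.subset_normalClosure h)
    rw [map_mul, map_inv] at this
    exact mul_inv_eq_one.mp this
  refine ⟨F ⧸ N, inferInstance, mk.comp j, fun k => mk (α k), ?_, ⟨?_, ?_, ?_, ?_⟩, ?_, ?_⟩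
  · exact Group.IsFinitelyPresented.quotient N ⟨R, hR, rfl⟩
  · intro k s hs
    have := hmk (j s * α k * (j s)⁻¹) (α k)
      (Or.inl (Or.inl (Or.inl (Set.mem_iUnion.mpr ⟨k, s, hs, rfl⟩))))
    simpa using this
  · intro k
    have := hmk (j w * α k * (j w)⁻¹) (α k ^ e k) (Or.inl (Or.inl (Or.inr ⟨k, rfl⟩)))
    simpa using this
  · intro k p hp
    have := hmk (j p.2 * α k * (j p.2)⁻¹) (α k * (j p.1 * α k * (j p.1)⁻¹))
      (Or.inl (Or.inr (Set.mem_iUnion.mpr ⟨k, p, hp, rfl⟩)))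
    simpa using this
  · intro k l q hq
    have := hmk (α k * (j q * α l * (j q)⁻¹)) ((j q * α l * (j q)⁻¹) * α k)
      (Or.inr (Set.mem_iUnion.mpr ⟨k, Set.mem_iUnion.mpr ⟨l, q, hq, rfl⟩⟩))
    show _ = _
    simpa using this
  · have : Subgroup.closure (Set.range j ∪ Set.range α) = ⊤ := by
      rw [eq_top_iff]; intro x _; exact hgen x
    have h := congrArg (Subgroup.map mk) this
    rw [MonoidHom.map_closure, Subgroup.map_top_of_surjective _ (QuotientGroup.mk'_surjective N),
      Set.image_union, ← Set.range_comp, ← Set.range_comp] at h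
    exact h
  · intro H _ ι' a' h
    obtain ⟨Φ, h1, h2⟩ := huni H ι' a'
    have hN : N ≤ Φ.ker := by
      refine Subgroup.normalClosure_le_normal ?_
      rintro x (((hx | hx) | hx) | hx)
      · obtain ⟨k, s, hs, rfl⟩ := Set.mem_iUnion.mp hx
        simp only [SetLike.mem_coe, MonoidHom.mem_ker, map_mul, map_inv, h1, h2, h.st k s hs]
        simp
      · obtain ⟨k, rfl⟩ := hx
        simp only [SetLike.mem_coe, MonoidHom.mem_ker, map_mul, map_inv, map_pow, h1, h2, h.ww k]
        simp
      · obtain ⟨k, s, hs, rfl⟩ := Set.mem_iUnion.mp hx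
        simp only [SetLike.mem_coe, MonoidHom.mem_ker, map_mul, map_inv, h1, h2, h.pr k s hs]
        group
      · obtain ⟨k, hx⟩ := Set.mem_iUnion.mp hx
        obtain ⟨l, s, hs, rfl⟩ := Set.mem_iUnion.mp hx
        have := (h.cm k l s hs).eq
        simp only [SetLike.mem_coe, MonoidHom.mem_ker, map_mul, map_inv, h1, h2]
        rw [this, mul_inv_cancel]
    refine ⟨QuotientGroup.lift N Φ hN, fun q => ?_, fun k => ?_⟩
    · exact h1 q
    · exact h2 k

theorem fq_exists_group {Q I : Type} [Group Q] [Finite I] (hQ : Group.IsFinitelyPresented Q)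
    (St : I → Set Q) (Pr : I → Set (Q × Q)) (w : Q) (e : I → ℕ) (B : Set Q)
    (hSt : ∀ k, (St k).Finite) (hPr : ∀ k, (Pr k).Finite) (hB : B.Finite) :
    ∃ (G : Type) (_ : Group G) (ι : Q →* G) (a : I → G),
      Group.IsFinitelyPresented G ∧ FqRels ι a St Pr w e B ∧
      Subgroup.closure (Set.range ι ∪ Set.range a) = ⊤ ∧
      ∀ (H : Type) [Group H] (ι' : Q →* H) (a' : I → H), FqRels ι' a' St Pr w e B →
        ∃ ψ : G →* H, (∀ q, ψ (ι q) = ι' q) ∧ (∀ k, ψ (a k) = a' k) := by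
  refine fq_exists_quot (F := Monoid.Coprod Q (FreeGroup I)) inferInstance Monoid.Coprod.inl
    (fun k => Monoid.Coprod.inr (FreeGroup.of k)) ?_ ?_ St Pr w e B hSt hPr hB
  · intro y
    induction y using Monoid.Coprod.induction_on with
    | inl q => exact Subgroup.subset_closure (Or.inl ⟨q, rfl⟩)
    | inr f =>
      induction f using FreeGroup.induction_on with
      | C1 => rw [map_one]; exact one_mem _
      | of k => exact Subgroup.subset_closure (Or.inr ⟨k, rfl⟩)
      | inv_of k ih => rw [map_inv]; exact inv_mem ih
      | mul x y hx hy => rw [map_mul]; exact mul_mem hx hy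
    | mul x y hx hy => exact mul_mem hx hy
  · intro H _ ι' a'
    refine ⟨Monoid.Coprod.lift ι' (FreeGroup.lift a'), fun q => by simp, fun k => by simp⟩

/-- The right translation operator minus the identity. -/
def fqDelta {Q : Type} [Group Q] (z : Q) (v : Q → ℝ) : Q → ℝ := fun g => v (g * z) - v g

theorem fq_main {Q I : Type} [Group Q] [Finite I] (hQ : Group.IsFinitelyPresented Q)
    (h2 : ∀ p q : Q, ⁅p, q⁆ ∈ Subgroup.center Q)
    (St : I → Set Q) (Pr : I → Set (Q × Q)) (w : Q) (e : I → ℕ) (B : Set Q)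
    (hSt : ∀ k, (St k).Finite) (hPr : ∀ k, (Pr k).Finite) (hB : B.Finite)
    (b : I → Q → ℝ)
    (hbst : ∀ k, ∀ s ∈ St k, ∀ g, b k (g * s) = b k g)
    (hbw : ∀ k g, b k (g * w) = e k * b k g)
    (hbpr : ∀ k, ∀ p ∈ Pr k, ∀ g, b k (g * p.2) = b k g + b k (g * p.1))
    (hder : ∀ (G : Type) [Group G] (ι : Q →* G) (a : I → G), FqRels ι a St Pr w e B →
      ∀ k l q, Commute (a k) (ι q * a l * (ι q)⁻¹))
    (hdet : ∀ z ∈ Subgroup.center Q, z ≠ 1 → ∃ k, ∀ c, (fqDelta z)^[c] (b k) ≠ 0) :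
    ∃ (n : ℕ) (rels : Set (FreeGroup (Fin n))), rels.Finite ∧
      ∃ (A : Subgroup (PresentedGroup rels)) (φ : PresentedGroup rels →* Q),
        A.Normal ∧ (∀ a b : A, a * b = b * a) ∧
        (∀ N : Subgroup (PresentedGroup rels), N.Normal → Group.IsNilpotent N → N ≤ A) ∧
        Function.Surjective φ ∧ φ.ker = A := by
  obtain ⟨G0, _, ι0, a0, hG, hrel0, hgen0, huniv0⟩ :=
    fq_exists_group hQ St Pr w e B hSt hPr hB
  obtain ⟨n, rels, hfin, ⟨E⟩⟩ : ∃ (n : ℕ) (rels : Set (FreeGroup (Fin n))), rels.Finite ∧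
      Nonempty (G0 ≃* PresentedGroup rels) := by
    have := hG.exists_mulEquiv_presentedGroup
    obtain ⟨n, rels, h1, h2⟩ := this
    exact ⟨n, rels, by first | exact h1 | exact h2, by first | exact h1 | exact h2⟩
  -- projection to Q
  obtain ⟨φ, hφι, hφa⟩ := huniv0 Q (MonoidHom.id Q) (fun _ => 1)
    ⟨by simp, by simp, by simp, by simp⟩
  -- representation by affine maps
  let T : (Q → ℝ) → Equiv.Perm (Q → ℝ) := fun t => Equiv.addRight t
  let ρ : Q →* Equiv.Perm (Q → ℝ) :=
    { toFun := fun q =>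
        { toFun := fun v g => v (g * q)
          invFun := fun v g => v (g * q⁻¹)
          left_inv := fun v => by ext g; simp
          right_inv := fun v => by ext g; simp }
      map_one' := by ext v g; simp
      map_mul' := fun p q => by ext v g; simp [mul_assoc] }
  have hρ : ∀ q v g, ρ q v g = v (g * q) := fun _ _ _ => rfl
  have hT : ∀ t v, T t v = v + t := fun _ _ => rfl
  have hTmul : ∀ s t, T s * T t = T (t + s) := by
    intro s t; ext v g; simp [hT, add_assoc]
  have hTpow : ∀ s (n : ℕ), T s ^ n = T (n • s) := by
    intro s n
    induction n with
    | zero => ext v g; simp [hT]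
    | succ n ih => rw [pow_succ, ih, hTmul, succ_nsmul, add_comm]
  have hconj : ∀ q t, ρ q * T t * (ρ q)⁻¹ = T (ρ q t) := by
    intro q t
    rw [mul_inv_eq_iff_eq_mul]
    ext v g
    simp [hT, hρ]
  obtain ⟨Ψ, hΨι, hΨa⟩ := huniv0 (Equiv.Perm (Q → ℝ)) ρ (fun k => T (b k)) (by
    refine ⟨?_, ?_, ?_, ?_⟩
    · intro k s hs
      rw [hconj]; congr 1; ext g; exact hbst k s hs g
    · intro k
      rw [hconj, hTpow]; congr 1; ext g; simp [hρ, hbw]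
    · intro k p hp
      rw [hconj, hconj, hTmul]; congr 1; ext g
      simp only [hρ, Pi.add_apply, hbpr k p hp g]; ring
    · intro k l q hq
      rw [hconj]
      show _ * _ = _ * _
      rw [hTmul, hTmul, add_comm])
  have haff : ∀ g : G0, ∀ v t, Ψ g (v + t) = Ψ g v + ρ (φ g) t := by
    intro g
    have hg : g ∈ Subgroup.closure (Set.range ι0 ∪ Set.range a0) := by rw [hgen0]; trivial
    induction hg using Subgroup.closure_induction with
    | mem x hx =>
      intro v t
      rcases hx with ⟨q, rfl⟩ | ⟨k, rfl⟩
      · rw [hΨι, hφι]; ext g; simp [hρ]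
      · rw [hΨa, hφa]; ext g; simp [hT]; ring
    | one => intro v t; simp
    | mul x y _ _ hx hy => intro v t; simp [hx, hy]
    | inv x _ hx =>
      intro v t
      rw [map_inv, map_inv, map_inv]
      apply (Ψ x).injective
      rw [hx]
      simp
  have hcomm : ∀ g : G0, ∀ t, Ψ g * T t * (Ψ g)⁻¹ = T (ρ (φ g) t) := by
    intro g t
    rw [mul_inv_eq_iff_eq_mul]
    ext1 v
    simp only [Equiv.Perm.mul_apply, hT, haff]
  have hder0 := hder G0 ι0 a0 hrel0
  -- the subgroup C
  let S : Set G0 := {x | ∃ q k, x = ι0 q * a0 k * (ι0 q)⁻¹}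
  let C := Subgroup.closure S
  have hCconj : ∀ q, ∀ c ∈ C, ι0 q * c * (ι0 q)⁻¹ ∈ C := by
    intro q c hc
    induction hc using Subgroup.closure_induction with
    | mem x hx =>
      obtain ⟨p, k, rfl⟩ := hx
      refine Subgroup.subset_closure ⟨q * p, k, ?_⟩
      rw [map_mul]; group
    | one => simp
    | mul x y _ _ hx hy =>
      have := mul_mem hx hy
      convert this using 1; group
    | inv x _ hx =>
      have := inv_mem hx
      convert this using 1; group
  have hCcomm : ∀ x ∈ C, ∀ y ∈ C, x * y = y * x := by
    have hS : ∀ x ∈ S, ∀ y ∈ S, x * y = y * x := by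
      rintro _ ⟨p, k, rfl⟩ _ ⟨q, l, rfl⟩
      have h := (hder0 k l (p⁻¹ * q)).eq
      have h' := congrArg (fun t => ι0 p * t * (ι0 p)⁻¹) h
      simp only [map_mul, map_inv] at h'
      simp only [mul_assoc, mul_inv_rev, inv_inv, mul_inv_cancel_left] at h' ⊢
      simpa [mul_assoc] using h'
    intro x hx y hy
    have hle : C ≤ Subgroup.centralizer S := by
      rw [Subgroup.closure_le]
      intro x hx y hy
      exact hS y hy x hx
    have hle2 : C ≤ Subgroup.centralizer (C : Set G0) := by
      rw [Subgroup.closure_le]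
      intro x hx y hy
      exact (Subgroup.mem_centralizer_iff.mp (hle hy) x hx).symm
    exact (Subgroup.mem_centralizer_iff.mp (hle2 hy) x hx)
  have hdecomp : ∀ g : G0, ∃ c ∈ C, g = c * ι0 (φ g) := by
    intro g
    have hg : g ∈ Subgroup.closure (Set.range ι0 ∪ Set.range a0) := by rw [hgen0]; trivial
    induction hg using Subgroup.closure_induction with
    | mem x hx =>
      rcases hx with ⟨q, rfl⟩ | ⟨k, rfl⟩
      · exact ⟨1, one_mem _, by simp [hφι]⟩
      · exact ⟨a0 k, Subgroup.subset_closure ⟨1, k, by simp⟩, by simp [hφa]⟩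
    | one => exact ⟨1, one_mem _, by simp⟩
    | mul x y _ _ hx hy =>
      obtain ⟨c, hc, h⟩ := hx
      obtain ⟨d, hd, h'⟩ := hy
      refine ⟨c * (ι0 (φ x) * d * (ι0 (φ x))⁻¹), mul_mem hc (hCconj _ _ hd), ?_⟩
      rw [map_mul, map_mul]
      nth_rewrite 1 [h, h']
      group
    | inv x _ hx =>
      obtain ⟨c, hc, h⟩ := hx
      refine ⟨ι0 (φ x)⁻¹ * c⁻¹ * (ι0 (φ x)⁻¹)⁻¹, hCconj _ _ (inv_mem hc), ?_⟩
      nth_rewrite 1 [h]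
      simp
  have hkercomm : ∀ x y : G0, φ x = 1 → φ y = 1 → x * y = y * x := by
    intro x y hx hy
    obtain ⟨c, hc, h⟩ := hdecomp x
    obtain ⟨d, hd, h'⟩ := hdecomp y
    rw [hx, map_one, mul_one] at h
    rw [hy, map_one, mul_one] at h'
    rw [h, h']
    exact hCcomm c hc d hd
  have hnil : ∀ N : Subgroup G0, N.Normal → Group.IsNilpotent N → ∀ g ∈ N, φ g = 1 := by
    intro N hN hNn
    by_contra! hcon
    obtain ⟨g, hgN, hg⟩ := hcon
    obtain ⟨m, hmN, hmz, hm1⟩ : ∃ m ∈ N, φ m ∈ Subgroup.center Q ∧ φ m ≠ 1 := by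
      by_cases hc : φ g ∈ Subgroup.center Q
      · exact ⟨g, hgN, hc, hg⟩
      · rw [Subgroup.mem_center_iff] at hc
        push Not at hc
        obtain ⟨q, hq⟩ := hc
        refine ⟨ι0 q * g * (ι0 q)⁻¹ * g⁻¹, mul_mem (hN.conj_mem g hgN _) (inv_mem hgN), ?_, ?_⟩
        · have := h2 q (φ g)
          simpa [commutatorElement_def, hφι] using this
        · simp only [map_mul, map_inv, hφι, MonoidHom.id_apply]
          intro h
          apply hq
          rw [mul_inv_eq_one, mul_inv_eq_iff_eq_mul] at h
          exact h
    obtain ⟨k, hk⟩ := hdet _ hmz hm1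
    have hseq : ∀ i, ∃ u ∈ N.lowerCentralSeries i, Ψ u = T ((fqDelta (φ m))^[i+1] (b k)) := by
      have hstep : ∀ u t, Ψ u = T t → Ψ ⁅m, u⁆ = T (fqDelta (φ m) t) := by
        intro u t hu
        rw [map_commutatorElement, commutatorElement_def, hu, hcomm]
        rw [mul_inv_eq_iff_eq_mul, hTmul]
        congr 1
        ext g
        simp [hρ, fqDelta]
      intro i
      induction i with
      | zero =>
        refine ⟨⁅m, a0 k⁆, ?_, ?_⟩
        · rw [Subgroup.lowerCentralSeries_zero, commutatorElement_def]
          have := mul_mem hmN (hN.conj_mem _ (inv_mem hmN) (a0 k))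
          simpa [mul_assoc] using this
        · exact hstep _ _ (hΨa k)
      | succ i ih =>
        obtain ⟨u, hu, hu'⟩ := ih
        refine ⟨⁅m, u⁆, ?_, ?_⟩
        · rw [Subgroup.lowerCentralSeries_succ, Subgroup.commutator_comm]
          exact Subgroup.commutator_mem_commutator hmN hu
        · rw [Function.iterate_succ_apply']
          exact hstep _ _ hu'
    obtain ⟨c, hc⟩ := (Subgroup.isNilpotent_iff_lowerCentralSeries N).mp hNn
    obtain ⟨u, hu, hu'⟩ := hseq c
    rw [hc, Subgroup.mem_bot] at hu
    rw [hu, map_one] at hu'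
    apply hk (c+1)
    have := congrArg (fun p : Equiv.Perm (Q → ℝ) => p 0) hu'
    simp only [Equiv.Perm.one_apply, hT, zero_add] at this
    exact this.symm
  let φ' : PresentedGroup rels →* Q := φ.comp E.symm.toMonoidHom
  have hφ' : ∀ x, φ' x = φ (E.symm x) := fun _ => rfl
  refine ⟨n, rels, hfin, φ'.ker, φ', inferInstance, ?_, ?_, ?_, rfl⟩
  · rintro ⟨x, hx⟩ ⟨y, hy⟩
    apply Subtype.ext
    apply E.symm.injective
    show E.symm (x * y) = E.symm (y * x)
    rw [map_mul, map_mul]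
    exact hkercomm _ _ hx hy
  · intro N hN hNn x hx
    have hn : (N.comap E.toMonoidHom).Normal := hN.comap _
    have hi : Group.IsNilpotent (N.comap E.toMonoidHom) := by
      let f : N.comap E.toMonoidHom →* N :=
        (E.toMonoidHom.comp (N.comap E.toMonoidHom).subtype).codRestrict N (fun x => x.2)
      have hf : Function.Injective f := by
        intro x y h
        apply Subtype.ext
        apply E.injective
        exact congrArg Subtype.val h
      refine Subgroup.isNilpotent_of_ker_le_center f ?_
      rw [(MonoidHom.ker_eq_bot_iff f).mpr hf]
      exact bot_le
    have := hnil _ hn hi (E.symm x) (by simpa using hx)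
    exact this
  · intro q
    exact ⟨E (ι0 q), by simp [hφ', hφι]⟩


theorem fq_compact {m : ℕ} (M : Set ((Fin m → ℝ) × (Fin m → ℝ))) (hM : M.Finite)
    (h : ∀ χ : Fin m → ℝ, χ ≠ 0 → ∃ v ∈ M, 0 < χ ⬝ᵥ v.1 ∧ 0 < χ ⬝ᵥ v.2) :
    ∃ R : ℝ, ∀ u : Fin m → ℝ, R < ‖u‖ → ∃ v ∈ M,
      (u - v.1) ⬝ᵥ (u - v.1) < u ⬝ᵥ u ∧ (u - v.2) ⬝ᵥ (u - v.2) < u ⬝ᵥ u := by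
  have hc : IsCompact (Metric.sphere (0 : Fin m → ℝ) 1) := isCompact_sphere _ _
  let U : ℕ → Set (Fin m → ℝ) := fun n => ⋃ v ∈ M,
    {χ | 1 / ((n : ℝ) + 1) < χ ⬝ᵥ v.1} ∩ {χ | 1 / ((n : ℝ) + 1) < χ ⬝ᵥ v.2}
  have hcont : ∀ v : Fin m → ℝ, Continuous fun χ : Fin m → ℝ => χ ⬝ᵥ v := by
    intro v
    unfold dotProduct
    fun_prop
  have hUo : ∀ n, IsOpen (U n) := by
    intro n
    refine isOpen_biUnion fun v _ => ?_
    exact (isOpen_lt continuous_const (hcont _)).inter (isOpen_lt continuous_const (hcont _))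
  have hmono : Monotone U := by
    intro n n' hn χ hχ
    simp only [U, Set.mem_iUnion, Set.mem_inter_iff, Set.mem_setOf_eq] at hχ ⊢
    obtain ⟨v, hv, h1, h2⟩ := hχ
    have : 1 / ((n' : ℝ) + 1) ≤ 1 / ((n : ℝ) + 1) := by
      have : (n : ℝ) ≤ n' := by exact_mod_cast hn
      gcongr
    exact ⟨v, hv, by linarith, by linarith⟩
  obtain ⟨n, hn⟩ := hc.elim_directed_cover U hUo (by
    intro χ hχ
    have hne : χ ≠ 0 := by
      rintro rfl
      simp at hχ
    obtain ⟨v, hv, h1, h2⟩ := h χ hne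
    obtain ⟨n, hn⟩ := exists_nat_one_div_lt (lt_min h1 h2)
    simp only [U, Set.mem_iUnion, Set.mem_inter_iff, Set.mem_setOf_eq]
    rw [lt_min_iff] at hn
    exact ⟨n, v, hv, hn.1, hn.2⟩) (directed_of_isDirected_le hmono)
  obtain ⟨R, hR⟩ : ∃ R : ℝ, ∀ v ∈ M, v.1 ⬝ᵥ v.1 ≤ R ∧ v.2 ⬝ᵥ v.2 ≤ R := by
    obtain ⟨R1, h1⟩ := (hM.image (fun v => v.1 ⬝ᵥ v.1)).bddAbove
    obtain ⟨R2, h2⟩ := (hM.image (fun v => v.2 ⬝ᵥ v.2)).bddAbove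
    exact ⟨max R1 R2, fun v hv => ⟨le_max_of_le_left (h1 ⟨v, hv, rfl⟩),
      le_max_of_le_right (h2 ⟨v, hv, rfl⟩)⟩⟩
  refine ⟨max 0 (R * (n + 1)), fun u hu => ?_⟩
  rw [max_lt_iff] at hu
  obtain ⟨hu0, huR⟩ := hu
  have hmem : (‖u‖⁻¹ • u) ∈ Metric.sphere (0 : Fin m → ℝ) 1 := by
    rw [mem_sphere_zero_iff_norm, norm_smul, norm_inv, norm_norm, inv_mul_cancel₀ hu0.ne']
  have := hn hmem
  simp only [U, Set.mem_iUnion, Set.mem_inter_iff, Set.mem_setOf_eq, smul_dotProduct,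
    smul_eq_mul] at this
  obtain ⟨v, hv, h1, h2⟩ := this
  have key : ∀ x : Fin m → ℝ, x ⬝ᵥ x ≤ R → 1 / ((n : ℝ) + 1) < ‖u‖⁻¹ * u ⬝ᵥ x →
      (u - x) ⬝ᵥ (u - x) < u ⬝ᵥ u := by
    intro x hx h
    rw [div_lt_iff₀ (by positivity), inv_mul_eq_div, div_mul_eq_mul_div,
      lt_div_iff₀ hu0] at h
    have hpos : (0 : ℝ) < n + 1 := by positivity
    have h3 : R < u ⬝ᵥ x := by
      nlinarith
    have h4 : 0 < u ⬝ᵥ x := by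
      nlinarith
    rw [sub_dotProduct, dotProduct_sub, dotProduct_sub, dotProduct_comm x u]
    linarith
  exact ⟨v, hv, key _ (hR v hv).1 h1, key _ (hR v hv).2 h2⟩

/-- The moves available for a generator. -/
def fqMoves {Q : Type} [Group Q] (St : Set Q) (Pr : Set (Q × Q)) : Set (Q × Q) :=
  (fun d => (d, d)) '' St ∪ (fun d => (d⁻¹, d⁻¹)) '' St ∪ Pr ∪
    (fun p => (p.2⁻¹, p.2⁻¹ * p.1)) '' Pr ∪ (fun p => (p.1⁻¹, p.1⁻¹ * p.2)) '' Pr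

theorem fqMoves_finite {Q : Type} [Group Q] {St : Set Q} {Pr : Set (Q × Q)}
    (h1 : St.Finite) (h2 : Pr.Finite) : (fqMoves St Pr).Finite :=
  ((((h1.image _).union (h1.image _)).union h2).union (h2.image _)).union (h2.image _)

theorem fqMoves_mem {Q I G : Type} [Group Q] [Group G] {ι : Q →* G} {a : I → G}
    {St : I → Set Q} {Pr : I → Set (Q × Q)} {w : Q} {e : I → ℕ} {B : Set Q}
    (h : FqRels ι a St Pr w e B) (k : I) (p : Q × Q) (hp : p ∈ fqMoves (St k) (Pr k))
    (H : Subgroup G) (q : Q) (h1 : ι (q * p.1) * a k * (ι (q * p.1))⁻¹ ∈ H)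
    (h2 : ι (q * p.2) * a k * (ι (q * p.2))⁻¹ ∈ H) : ι q * a k * (ι q)⁻¹ ∈ H := by
  rcases hp with (((⟨d, hd, rfl⟩ | ⟨d, hd, rfl⟩) | hp) | ⟨p, hp, rfl⟩) | ⟨p, hp, rfl⟩
  · have := h.st k d hd
    rw [show ι (q * d) * a k * (ι (q * d))⁻¹ = ι q * (ι d * a k * (ι d)⁻¹) * (ι q)⁻¹ by
      rw [map_mul]; group, this] at h1
    exact h1
  · have := h.st k d hd
    have h' : a k = (ι d)⁻¹ * a k * ι d := by
      nth_rewrite 2 [← this]; group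
    rw [h']
    convert h1 using 1
    simp only [map_mul, map_inv]; group
  · have := h.pr k p hp
    have h' : a k = (ι p.2 * a k * (ι p.2)⁻¹) * (ι p.1 * a k * (ι p.1)⁻¹)⁻¹ := by
      rw [this]; group
    rw [h']
    convert mul_mem h2 (inv_mem h1) using 1
    simp only [map_mul]; group
  · have := h.pr k p hp
    have h' : a k = (ι p.2)⁻¹ * (a k * (ι p.1 * a k * (ι p.1)⁻¹)) * ι p.2 := by
      rw [← this]; group
    rw [h']
    convert mul_mem h1 h2 using 1
    simp only [map_mul, map_inv]; group
  · have := h.pr k p hp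
    have h' : a k = (ι p.1)⁻¹ * ((a k)⁻¹ * (ι p.2 * a k * (ι p.2)⁻¹)) * ι p.1 := by
      rw [this]; group
    rw [h']
    convert mul_mem (inv_mem h1) h2 using 1
    simp only [map_mul, map_inv]; group

theorem fq_der {Q I : Type} [Group Q] [Finite I] {m : ℕ} (π : Q → Fin m → ℤ)
    (hπ : ∀ p q, π (p * q) = π p + π q) (w : Q) (hw : w ∈ Subgroup.center Q)
    (Zp : Subgroup Q)
    (hfin : ∀ R : ℝ, ∃ B : Set Q, B.Finite ∧ ∀ q, ‖fun i => (π q i : ℝ)‖ ≤ R →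
      ∃ b ∈ B, ∃ κ ∈ Zp, q = b * κ)
    (St : I → Set Q) (Pr : I → Set (Q × Q))
    (hSt : ∀ k, (St k).Finite) (hPr : ∀ k, (Pr k).Finite)
    (hκ : ∀ κ ∈ Zp, ∀ l, ∃ j : ℤ, ∃ κ₀ ∈ Subgroup.closure (St l), κ = w ^ j * κ₀)
    (crit : ∀ χ : Fin m → ℝ, χ ≠ 0 → ∀ k l,
      (∃ p ∈ fqMoves (St k) (Pr k), 0 < (χ ⬝ᵥ fun i => (π p.1 i : ℝ)) ∧
        0 < (χ ⬝ᵥ fun i => (π p.2 i : ℝ))) ∨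
      (∃ p ∈ fqMoves (St l) (Pr l), (χ ⬝ᵥ fun i => (π p.1 i : ℝ)) < 0 ∧
        (χ ⬝ᵥ fun i => (π p.2 i : ℝ)) < 0)) :
    ∃ B : Set Q, B.Finite ∧ ∀ (e : I → ℕ) (G : Type) [Group G] (ι : Q →* G) (a : I → G),
      FqRels ι a St Pr w e B → ∀ k l q, Commute (a k) (ι q * a l * (ι q)⁻¹) := by
  classical
  let v : Q → Fin m → ℝ := fun q i => (π q i : ℝ)
  have hv : ∀ p q, v (p * q) = v p + v q := by
    intro p q; ext i; simp [v, hπ]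
  have hv1 : v 1 = 0 := by
    have := hv 1 1
    simpa using this
  have hvinv : ∀ p, v p⁻¹ = - v p := by
    intro p
    have := hv p p⁻¹
    rw [mul_inv_cancel, hv1] at this
    exact (neg_eq_of_add_eq_zero_right this.symm).symm
  have hRex : ∀ k l, ∃ R : ℝ, ∀ q, R < ‖v q‖ →
      (∃ p ∈ fqMoves (St k) (Pr k), v (p.1⁻¹ * q) ⬝ᵥ v (p.1⁻¹ * q) < v q ⬝ᵥ v q ∧
        v (p.2⁻¹ * q) ⬝ᵥ v (p.2⁻¹ * q) < v q ⬝ᵥ v q) ∨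
      (∃ p ∈ fqMoves (St l) (Pr l), v (q * p.1) ⬝ᵥ v (q * p.1) < v q ⬝ᵥ v q ∧
        v (q * p.2) ⬝ᵥ v (q * p.2) < v q ⬝ᵥ v q) := by
    intro k l
    obtain ⟨R, hR⟩ := fq_compact
      ((fun p : Q × Q => (v p.1, v p.2)) '' fqMoves (St k) (Pr k) ∪
        (fun p : Q × Q => (- v p.1, - v p.2)) '' fqMoves (St l) (Pr l))
      (((fqMoves_finite (hSt k) (hPr k)).image _).union
        ((fqMoves_finite (hSt l) (hPr l)).image _)) (by
        intro χ hχ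
        rcases crit χ hχ k l with ⟨p, hp, h1, h2⟩ | ⟨p, hp, h1, h2⟩
        · exact ⟨_, Or.inl ⟨p, hp, rfl⟩, h1, h2⟩
        · refine ⟨_, Or.inr ⟨p, hp, rfl⟩, ?_, ?_⟩
          · simp only [dotProduct_neg]; simpa using h1
          · simp only [dotProduct_neg]; simpa using h2)
    refine ⟨R, fun q hq => ?_⟩
    obtain ⟨x, hx | hx, h1, h2⟩ := hR (v q) hq
    · obtain ⟨p, hp, rfl⟩ := hx
      refine Or.inl ⟨p, hp, ?_, ?_⟩
      · rw [hv, hvinv, neg_add_eq_sub]; exact h1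
      · rw [hv, hvinv, neg_add_eq_sub]; exact h2
    · obtain ⟨p, hp, rfl⟩ := hx
      refine Or.inr ⟨p, hp, ?_, ?_⟩
      · rw [hv, ← sub_neg_eq_add]; exact h1
      · rw [hv, ← sub_neg_eq_add]; exact h2
  choose R hR using hRex
  obtain ⟨R', hR'⟩ := (Set.finite_range (fun p : I × I => R p.1 p.2)).bddAbove
  obtain ⟨B, hB, hBq⟩ := hfin R'
  refine ⟨B, hB, ?_⟩
  intro e G _ ι a h k l
  have hnat : ∀ q, ∃ n : ℕ, v q ⬝ᵥ v q = n := by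
    intro q
    refine ⟨(π q ⬝ᵥ π q).toNat, ?_⟩
    have h0 : 0 ≤ π q ⬝ᵥ π q := Finset.sum_nonneg fun i _ => mul_self_nonneg _
    have : ((π q ⬝ᵥ π q : ℤ) : ℝ) = v q ⬝ᵥ v q := by simp [v, dotProduct]
    rw [← this]
    have h1 : (((π q ⬝ᵥ π q).toNat : ℤ)) = π q ⬝ᵥ π q := Int.toNat_of_nonneg h0
    exact_mod_cast h1.symm
  -- conjugation by powers of w
  have hwj : ∀ (l : I) (j : ℕ), ι (w ^ j) * a l * (ι (w ^ j))⁻¹ = a l ^ (e l ^ j) := by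
    intro l j
    induction j with
    | zero => simp
    | succ j ih =>
      rw [pow_succ', map_mul, show ι w * ι (w ^ j) * a l * (ι w * ι (w ^ j))⁻¹ =
        ι w * (ι (w ^ j) * a l * (ι (w ^ j))⁻¹) * (ι w)⁻¹ by group, ih, ← conj_pow, h.ww,
        ← pow_mul, pow_succ']
  have hfix : ∀ (l : I), ∀ s ∈ Subgroup.closure (St l), ι s * a l * (ι s)⁻¹ = a l := by
    intro l s hs
    induction hs using Subgroup.closure_induction with
    | mem x hx => exact h.st l x hx
    | one => simp
    | mul x y _ _ hx hy =>
      rw [map_mul, show ι x * ι y * a l * (ι x * ι y)⁻¹ =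
        ι x * (ι y * a l * (ι y)⁻¹) * (ι x)⁻¹ by group, hy, hx]
    | inv x _ hx =>
      nth_rewrite 1 [← hx]
      rw [map_inv]; group
  have hwc : ∀ (j : ℤ) (g : Q), w ^ j * g = g * w ^ j := fun j g =>
    ((Subgroup.mem_center_iff.mp (zpow_mem hw j)) g).symm
  have main : ∀ (n : ℕ) q, v q ⬝ᵥ v q = n → Commute (a k) (ι q * a l * (ι q)⁻¹) := by
    intro n
    induction n using Nat.strong_induction_on with
    | _ n ih =>
    intro q hq
    by_cases hlarge : R k l < ‖v q‖
    · have ih' : ∀ q', v q' ⬝ᵥ v q' < v q ⬝ᵥ v q → Commute (a k) (ι q' * a l * (ι q')⁻¹) := by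
        intro q' hq'
        obtain ⟨n', hn'⟩ := hnat q'
        refine ih n' ?_ q' hn'
        rw [hn', hq] at hq'
        exact_mod_cast hq'
      rcases hR k l q hlarge with ⟨p, hp, h1, h2⟩ | ⟨p, hp, h1, h2⟩
      · have key : ∀ p, Commute (a k) (ι (p⁻¹ * q) * a l * (ι (p⁻¹ * q))⁻¹) →
            ι (1 * p) * a k * (ι (1 * p))⁻¹ ∈
              Subgroup.centralizer {ι q * a l * (ι q)⁻¹} := by
          intro p hp
          rw [Subgroup.mem_centralizer_singleton_iff]
          have h' := congrArg (fun t => ι p * t * (ι p)⁻¹) hp.eq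
          simp only [map_mul, map_inv] at h'
          rw [one_mul]
          simp only [mul_assoc, mul_inv_rev, inv_inv, mul_inv_cancel_left] at h' ⊢
          simpa [mul_assoc] using h'
        have := fqMoves_mem h k p hp (Subgroup.centralizer {ι q * a l * (ι q)⁻¹}) 1
          (key _ (ih' _ h1)) (key _ (ih' _ h2))
        rw [Subgroup.mem_centralizer_singleton_iff] at this
        show _ = _
        simpa using this
      · have := fqMoves_mem h l p hp (Subgroup.centralizer {a k}) q
          (by
            rw [Subgroup.mem_centralizer_singleton_iff]
            exact (ih' _ h1).eq.symm)
          (by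
            rw [Subgroup.mem_centralizer_singleton_iff]
            exact (ih' _ h2).eq.symm)
        rw [Subgroup.mem_centralizer_singleton_iff] at this
        exact this.symm
    · have hle : ‖v q‖ ≤ R' := (not_lt.mp hlarge).trans (hR' ⟨(k, l), rfl⟩)
      obtain ⟨b, hb, κ, hκZ, rfl⟩ := hBq q hle
      obtain ⟨j, κ₀, hκ₀, rfl⟩ := hκ κ hκZ l
      have hb' := h.cm k l b hb
      have e1 : ι (b * (w ^ j * κ₀)) * a l * (ι (b * (w ^ j * κ₀)))⁻¹ =
          ι b * (ι (w ^ j) * a l * (ι (w ^ j))⁻¹) * (ι b)⁻¹ := by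
        nth_rewrite 2 [← hfix l κ₀ hκ₀]
        simp only [map_mul]; group
      rw [e1]
      rcases Int.eq_nat_or_neg j with ⟨i, rfl | rfl⟩
      · rw [zpow_natCast, hwj, ← conj_pow]
        exact hb'.pow_right _
      · have h3 : Commute (a k ^ (e k ^ i)) (ι b * a l * (ι b)⁻¹) := hb'.pow_left _
        rw [← hwj] at h3
        have h4 := congrArg (fun t => (ι (w ^ i))⁻¹ * t * (ι (w ^ i))) h3.eq
        have e2 : ι (w ^ (-(i : ℤ))) = (ι (w ^ i))⁻¹ := by simp
        have e3 : ι b * (ι (w ^ i))⁻¹ = (ι (w ^ i))⁻¹ * ι b := by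
          rw [← e2, ← map_mul, ← map_mul, hwc]
        have e4 : ι b * ((ι (w ^ i))⁻¹ * a l * ι (w ^ i)) * (ι b)⁻¹ =
            (ι (w ^ i))⁻¹ * (ι b * a l * (ι b)⁻¹) * ι (w ^ i) := by
          calc _ = (ι b * (ι (w ^ i))⁻¹) * a l * (ι b * (ι (w ^ i))⁻¹)⁻¹ := by group
            _ = _ := by rw [e3]; group
        rw [e2, inv_inv, e4]
        show _ = _
        simp only [mul_assoc, inv_mul_cancel_left] at h4 ⊢
        simpa [mul_assoc] using h4
  intro q
  obtain ⟨n, hn⟩ := hnat q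
  exact main n q hn

theorem fq_avoid {V : Type} [AddCommGroup V] [Module ℚ V] (U : Submodule ℚ V)
    (S : Set (Submodule ℚ V)) (hS : S.Finite) (h : ∀ W ∈ S, ¬ U ≤ W) :
    ∃ x ∈ U, ∀ W ∈ S, x ∉ W := by
  classical
  have hfin := hS.image (Submodule.comap U.subtype)
  have := Subspace.biUnion_ne_univ_of_top_notMem (k := ℚ) (E := U) (s := hfin.toFinset) (by
    intro hmem
    rw [Set.Finite.mem_toFinset] at hmem
    obtain ⟨W, hW, hWt⟩ := hmem
    apply h W hW
    intro x hx
    have : (⟨x, hx⟩ : U) ∈ (⊤ : Submodule ℚ U) := trivial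
    rw [← hWt] at this
    exact this)
  rw [Ne, Set.eq_univ_iff_forall] at this
  push Not at this
  obtain ⟨x, hx⟩ := this
  refine ⟨x, x.2, fun W hW hxW => hx ?_⟩
  simp only [Set.Finite.mem_toFinset, Set.mem_iUnion]
  exact ⟨W.comap U.subtype, ⟨W, hW, rfl⟩, hxW⟩

/-- The three vectors attached to a hyperbolic pair. -/
def fqU {V : Type} [AddCommGroup V] {n : ℕ} (x y : Fin n → V) (φ : Fin n → Fin 3) (i : Fin n) : V :=
  if φ i = 0 then x i else if φ i = 1 then y i else x i - y i

theorem fq_avoid_three {V : Type} [AddCommGroup V] [Module ℚ V] (ω : V →ₗ[ℚ] V →ₗ[ℚ] ℚ)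
    (U : Submodule ℚ V)
    (S : Set (Submodule ℚ V)) (hS : S.Finite) (h : ∀ W ∈ S, ¬ U ≤ W)
    (hU : ∃ u ∈ U, ∃ v ∈ U, ω u v ≠ 0) :
    ∃ x ∈ U, ∃ y ∈ U, ω x y ≠ 0 ∧ ∀ W ∈ S, x ∉ W ∧ y ∉ W ∧ x - y ∉ W := by
  classical
  obtain ⟨u, hu, v, hv, huv⟩ := hU
  obtain ⟨x, hxU, hx⟩ := fq_avoid U (insert (LinearMap.ker (ω.flip v)) S) (hS.insert _) (by
    intro W hW
    rcases hW with rfl | hW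
    · intro hle
      exact huv (by simpa using hle hu)
    · exact h W hW)
  have hxv : ω x v ≠ 0 := by
    have := hx _ (Set.mem_insert _ _)
    simpa using this
  obtain ⟨y₀, hyU, hy⟩ := fq_avoid U (insert (LinearMap.ker (ω x)) S) (hS.insert _) (by
    intro W hW
    rcases hW with rfl | hW
    · intro hle
      exact hxv (by simpa using hle hv)
    · exact h W hW)
  have hxy : ω x y₀ ≠ 0 := by
    have := hy _ (Set.mem_insert _ _)
    simpa using this
  have hbad : (⋃ W ∈ S, {t : ℚ | x - t • y₀ ∈ W}).Finite := by
    refine hS.biUnion fun W hW => Set.Subsingleton.finite ?_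
    intro t ht t' ht'
    by_contra hne
    have h1 : (t' - t) • y₀ ∈ W := by
      have := W.sub_mem ht ht'
      convert this using 1
      rw [sub_smul]; abel
    have h2 : y₀ ∈ W := by
      have := W.smul_mem (t' - t)⁻¹ h1
      rwa [smul_smul, inv_mul_cancel₀ (sub_ne_zero.mpr (Ne.symm hne)), one_smul] at this
    exact hy W (Set.mem_insert_of_mem _ hW) h2
  obtain ⟨t, ht⟩ := (hbad.insert 0).exists_notMem
  have ht0 : t ≠ 0 := fun h => ht (h ▸ Set.mem_insert _ _)
  refine ⟨x, hxU, t • y₀, U.smul_mem _ hyU, by simp [ht0, hxy], fun W hW =>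
    ⟨hx W (Set.mem_insert_of_mem _ hW), ?_, ?_⟩⟩
  · intro hmem
    have := W.smul_mem t⁻¹ hmem
    rw [smul_smul, inv_mul_cancel₀ ht0, one_smul] at this
    exact hy W (Set.mem_insert_of_mem _ hW) this
  · intro hmem
    apply ht
    refine Set.mem_insert_of_mem _ ?_
    simp only [Set.mem_iUnion]
    exact ⟨W, hW, hmem⟩

theorem fq_lemmaH {V : Type} [AddCommGroup V] [Module ℚ V] [FiniteDimensional ℚ V]
    (ω : V →ₗ[ℚ] V →ₗ[ℚ] ℚ) (hω : ∀ v, ω v v = 0) (D : Submodule ℚ V) :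
    ∀ (d : ℕ) (U : Submodule ℚ V), Module.finrank ℚ U = d →
    (∀ v, v ∈ D ↔ v ∈ U ∧ ∀ u ∈ U, ω v u = 0) →
    ∀ (𝒩 : Set (Submodule ℚ V)), 𝒩.Finite →
    (∀ N ∈ 𝒩, N ≤ U ∧ Module.finrank ℚ U + Module.finrank ℚ D ≤ 2 * Module.finrank ℚ N) →
    ∃ (n : ℕ) (x y : Fin n → V), (∀ i, x i ∈ U) ∧ (∀ i, y i ∈ U) ∧
      (∀ i j, ω (x i) (x j) = 0) ∧ (∀ i j, ω (y i) (y j) = 0) ∧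
      (∀ i j, i ≠ j → ω (x i) (y j) = 0) ∧ (∀ i, ω (x i) (y i) ≠ 0) ∧
      U ≤ D ⊔ Submodule.span ℚ (Set.range x) ⊔ Submodule.span ℚ (Set.range y) ∧
      2 * n + Module.finrank ℚ D ≤ Module.finrank ℚ U ∧
      ∀ N ∈ 𝒩, ∀ φ : Fin n → Fin 3,
        U ≤ D ⊔ Submodule.span ℚ (Set.range (fqU x y φ)) ⊔ N := by
  classical
  have hsk : ∀ u v, ω u v = - ω v u := by
    intro u v
    have h := hω (u + v)
    simp only [map_add, LinearMap.add_apply, hω] at h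
    linarith
  intro d
  induction d using Nat.strong_induction_on with
  | _ d ih =>
  intro U hUd hD 𝒩 h𝒩 hN
  have hDU : D ≤ U := fun v hv => ((hD v).mp hv).1
  by_cases hUD : U ≤ D
  · refine ⟨0, Fin.elim0, Fin.elim0, fun i => i.elim0, fun i => i.elim0, fun i => i.elim0,
      fun i => i.elim0, fun i => i.elim0, fun i => i.elim0, ?_, ?_, ?_⟩
    · exact le_sup_of_le_left (le_sup_of_le_left hUD)
    · simpa using Submodule.finrank_mono hDU
    · intro N _ φ
      exact le_sup_of_le_left (le_sup_of_le_left hUD)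
  have hDlt : Module.finrank ℚ D < Module.finrank ℚ U :=
    Submodule.finrank_lt_finrank_of_lt (lt_of_le_not_ge hDU hUD)
  -- choose the pair
  let perp : Submodule ℚ V → Submodule ℚ V := fun N => Submodule.orthogonalBilin ω N
  have hperp : ∀ N v, v ∈ perp N ↔ ∀ u ∈ N, ω u v = 0 := by
    intro N v
    exact Submodule.mem_orthogonalBilin_iff
  obtain ⟨x, hxU, y, hyU, hxy, hav⟩ := fq_avoid_three ω U ({N ∈ 𝒩 | ¬ U ≤ N} ∪ perp '' 𝒩)
    ((h𝒩.subset (Set.sep_subset _ _)).union (h𝒩.image _)) (by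
      rintro W (hW | ⟨N, hNN, rfl⟩)
      · exact hW.2
      · intro hle
        have hND : N ≤ D := by
          intro v hv
          rw [hD]
          refine ⟨(hN N hNN).1 hv, fun u hu => ?_⟩
          exact (hperp N u).mp (hle hu) v hv
        have h1 := Submodule.finrank_mono hND
        have h2 := (hN N hNN).2
        omega) (by
      obtain ⟨u, hu, huD⟩ := Set.not_subset.mp hUD
      rw [SetLike.mem_coe, hD] at huD
      push Not at huD
      obtain ⟨v, hv, h⟩ := huD hu
      exact ⟨u, hu, v, hv, h⟩)
  have hyx : ω y x = - ω x y := hsk y x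
  let U₁ : Submodule ℚ V := U ⊓ LinearMap.ker (ω x) ⊓ LinearMap.ker (ω y)
  have hU₁ : ∀ v, v ∈ U₁ ↔ v ∈ U ∧ ω x v = 0 ∧ ω y v = 0 := by
    intro v
    simp [U₁, and_assoc]
  have hU₁U : U₁ ≤ U := fun v hv => ((hU₁ v).mp hv).1
  have hdec : ∀ v ∈ U, v - (-(ω y v) / ω x y) • x - (ω x v / ω x y) • y ∈ U₁ := by
    intro v hv
    rw [hU₁]
    refine ⟨U.sub_mem (U.sub_mem hv (U.smul_mem _ hxU)) (U.smul_mem _ hyU), ?_, ?_⟩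
    · simp [hω, hxy]
    · simp [hω, hxy, hyx]
  have hD₁ : ∀ v, v ∈ D ↔ v ∈ U₁ ∧ ∀ u ∈ U₁, ω v u = 0 := by
    intro v
    rw [hD, hU₁]
    constructor
    · rintro ⟨h1, h2⟩
      refine ⟨⟨h1, ?_, ?_⟩, fun u hu => h2 u (hU₁U hu)⟩
      · rw [hsk, h2 x hxU, neg_zero]
      · rw [hsk, h2 y hyU, neg_zero]
    · rintro ⟨⟨h1, h2, h3⟩, h4⟩
      refine ⟨h1, fun u hu => ?_⟩
      have := h4 _ (hdec u hu)
      rw [hsk] at h2 h3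
      simp only [map_sub, map_smul] at this
      rw [neg_eq_zero.mp h2, neg_eq_zero.mp h3] at this
      simpa using this
  have hDU₁ : D ≤ U₁ := fun v hv => ((hD₁ v).mp hv).1
  have hdim1 : Module.finrank ℚ U₁ + 2 ≤ Module.finrank ℚ U := by
    have h1 : U₁ < U₁ ⊔ Submodule.span ℚ {x} := by
      refine lt_of_le_not_ge le_sup_left fun h => ?_
      have : x ∈ U₁ := h (Submodule.mem_sup_right (Submodule.mem_span_singleton_self x))
      rw [hU₁, hyx] at this
      exact hxy (neg_eq_zero.mp this.2.2)
    have h2 : U₁ ⊔ Submodule.span ℚ {x} < U := by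
      refine lt_of_le_not_ge (sup_le hU₁U (by simpa using hxU)) fun h => ?_
      have h3 : U₁ ⊔ Submodule.span ℚ {x} ≤ LinearMap.ker (ω x) := by
        refine sup_le (fun v hv => ((hU₁ v).mp hv).2.1) ?_
        simp [hω]
      exact hxy (h3 (h hyU))
    have := Submodule.finrank_lt_finrank_of_lt h1
    have := Submodule.finrank_lt_finrank_of_lt h2
    omega
  have hdim2 : Module.finrank ℚ U ≤ Module.finrank ℚ U₁ + 2 := by
    have h1 : U ≤ U₁ ⊔ Submodule.span ℚ (Set.range ![x, y]) := by
      intro v hv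
      have h2 := hdec v hv
      have hxs : x ∈ Submodule.span ℚ (Set.range ![x, y]) := Submodule.subset_span ⟨0, rfl⟩
      have hys : y ∈ Submodule.span ℚ (Set.range ![x, y]) := Submodule.subset_span ⟨1, rfl⟩
      rw [show v = (v - (-(ω y v) / ω x y) • x - (ω x v / ω x y) • y) +
        ((-(ω y v) / ω x y) • x + (ω x v / ω x y) • y) by abel]
      exact Submodule.add_mem_sup h2
        (Submodule.add_mem _ (Submodule.smul_mem _ _ hxs) (Submodule.smul_mem _ _ hys))
    have h3 := Submodule.finrank_mono h1
    have h4 := Submodule.finrank_add_le_finrank_add_finrank U₁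
      (Submodule.span ℚ (Set.range ![x, y]))
    have h5 : Module.finrank ℚ (Submodule.span ℚ (Set.range ![x, y])) ≤ 2 := by
      have := finrank_range_le_card (R := ℚ) ![x, y]
      simpa [Set.finrank] using this
    omega
  let u3 : Fin 3 → V := fun c => if c = 0 then x else if c = 1 then y else x - y
  have hu3 : ∀ c, u3 c = x ∨ u3 c = y ∨ u3 c = x - y := by
    intro c
    simp only [u3]
    split_ifs <;> simp
  have hu3U : ∀ c, u3 c ∈ U := by
    intro c
    rcases hu3 c with h | h | h <;> rw [h]
    · exact hxU
    · exact hyU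
    · exact U.sub_mem hxU hyU
  have hu3N : ∀ c, ∀ N ∈ 𝒩, ¬ U ≤ N → u3 c ∉ N := by
    intro c N hNN hUN
    have := hav N (Or.inl ⟨hNN, hUN⟩)
    rcases hu3 c with h | h | h <;> rw [h] <;> tauto
  have hu3P : ∀ c, ∀ N ∈ 𝒩, ∃ v ∈ N, ω (u3 c) v ≠ 0 := by
    intro c N hNN
    have h0 := hav (perp N) (Or.inr ⟨N, hNN, rfl⟩)
    have h1 : u3 c ∉ perp N := by
      rcases hu3 c with h | h | h <;> rw [h] <;> tauto
    rw [hperp] at h1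
    push Not at h1
    obtain ⟨v, hv, h⟩ := h1
    refine ⟨v, hv, ?_⟩
    rw [hsk]
    simpa using h
  let 𝒩₁ : Set (Submodule ℚ V) :=
    ⋃ c, (fun N => (N ⊔ Submodule.span ℚ {u3 c}) ⊓ U₁) '' 𝒩
  obtain ⟨n, x₁, y₁, hx₁, hy₁, hxx, hyy, hxy0, hxy1, hspan, hcard, htr⟩ :=
    ih (Module.finrank ℚ U₁) (by omega) U₁ rfl hD₁ 𝒩₁
    (Set.finite_iUnion fun c => h𝒩.image _) (by
      intro N' hN'
      obtain ⟨c, N, hNN, rfl⟩ := Set.mem_iUnion.mp hN'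
      refine ⟨inf_le_right, ?_⟩
      have hsU : N ⊔ Submodule.span ℚ {u3 c} ≤ U :=
        sup_le (hN N hNN).1 (by simpa using hu3U c)
      have h1 := Submodule.finrank_sup_add_finrank_inf_eq (N ⊔ Submodule.span ℚ {u3 c}) U₁
      have h2 := Submodule.finrank_mono (sup_le hsU hU₁U)
      have h3 := (hN N hNN).2
      have h4 := Submodule.finrank_mono hDU₁
      by_cases hUN : U ≤ N
      · have h5 := Submodule.finrank_mono (hUN.trans
          (le_sup_left : N ≤ N ⊔ Submodule.span ℚ {u3 c}))
        simp only
        omega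
      · have h5 : N < N ⊔ Submodule.span ℚ {u3 c} := by
          refine lt_of_le_not_ge le_sup_left fun h => ?_
          exact hu3N c N hNN hUN
            (h (Submodule.mem_sup_right (Submodule.mem_span_singleton_self _)))
        have h6 := Submodule.finrank_lt_finrank_of_lt h5
        simp only
        omega)
  refine ⟨n + 1, Fin.cons x x₁, Fin.cons y y₁, ?_, ?_, ?_, ?_, ?_, ?_, ?_, ?_, ?_⟩
  · intro i
    refine Fin.cases ?_ (fun i => ?_) i
    · simpa using hxU
    · simpa using hU₁U (hx₁ i)
  · intro i
    refine Fin.cases ?_ (fun i => ?_) i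
    · simpa using hyU
    · simpa using hU₁U (hy₁ i)
  · intro i j
    refine Fin.cases ?_ (fun i => ?_) i <;> refine Fin.cases ?_ (fun j => ?_) j
    · simpa using hω x
    · simpa using ((hU₁ _).mp (hx₁ j)).2.1
    · rw [hsk]; simpa using ((hU₁ _).mp (hx₁ i)).2.1
    · simpa using hxx i j
  · intro i j
    refine Fin.cases ?_ (fun i => ?_) i <;> refine Fin.cases ?_ (fun j => ?_) j
    · simpa using hω y
    · simpa using ((hU₁ _).mp (hy₁ j)).2.2
    · rw [hsk]; simpa using ((hU₁ _).mp (hy₁ i)).2.2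
    · simpa using hyy i j
  · intro i j
    refine Fin.cases ?_ (fun i => ?_) i <;> refine Fin.cases ?_ (fun j => ?_) j
    · simp
    · intro _; simpa using ((hU₁ _).mp (hy₁ j)).2.1
    · intro _; rw [hsk]; simpa using ((hU₁ _).mp (hx₁ i)).2.2
    · intro hij; simpa using hxy0 i j (fun h => hij (by rw [h]))
  · intro i
    refine Fin.cases ?_ (fun i => ?_) i
    · simpa using hxy
    · simpa using hxy1 i
  · intro v hv
    rw [Fin.range_cons, Fin.range_cons]
    have hle : U₁ ≤ D ⊔ Submodule.span ℚ (insert x (Set.range x₁)) ⊔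
        Submodule.span ℚ (insert y (Set.range y₁)) :=
      hspan.trans (sup_le_sup (sup_le_sup le_rfl (Submodule.span_mono (Set.subset_insert _ _)))
        (Submodule.span_mono (Set.subset_insert _ _)))
    have hxm : x ∈ D ⊔ Submodule.span ℚ (insert x (Set.range x₁)) ⊔
        Submodule.span ℚ (insert y (Set.range y₁)) :=
      Submodule.mem_sup_left (Submodule.mem_sup_right
        (Submodule.subset_span (Set.mem_insert _ _)))
    have hym : y ∈ D ⊔ Submodule.span ℚ (insert x (Set.range x₁)) ⊔
        Submodule.span ℚ (insert y (Set.range y₁)) :=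
      Submodule.mem_sup_right (Submodule.subset_span (Set.mem_insert _ _))
    rw [show v = (v - (-(ω y v) / ω x y) • x - (ω x v / ω x y) • y) +
        ((-(ω y v) / ω x y) • x + (ω x v / ω x y) • y) by abel]
    exact Submodule.add_mem _ (hle (hdec v hv))
      (Submodule.add_mem _ (Submodule.smul_mem _ _ hxm) (Submodule.smul_mem _ _ hym))
  · omega
  · intro N hNN φ
    set W := D ⊔ Submodule.span ℚ (Set.range (fqU (Fin.cons x x₁) (Fin.cons y y₁) φ)) ⊔ N
      with hW
    have hNW : N ≤ W := le_sup_right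
    have huW : u3 (φ 0) ∈ W :=
      Submodule.mem_sup_left (Submodule.mem_sup_right (Submodule.subset_span ⟨0, rfl⟩))
    have hU₁W : U₁ ≤ W := by
      refine (htr _ (Set.mem_iUnion.mpr ⟨φ 0, N, hNN, rfl⟩) (fun i => φ i.succ)).trans ?_
      refine sup_le (sup_le (le_sup_of_le_left le_sup_left) ?_)
        (inf_le_left.trans (sup_le hNW (by simpa using huW)))
      refine le_sup_of_le_left (le_sup_of_le_right (Submodule.span_mono ?_))
      rintro _ ⟨i, rfl⟩
      exact ⟨i.succ, by simp [fqU]⟩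
    obtain ⟨v, hvN, hv⟩ := hu3P (φ 0) N hNN
    have hvW := hNW hvN
    have hvU := (hN N hNN).1 hvN
    have hcomb : (-(ω y v) / ω x y) • x + (ω x v / ω x y) • y ∈ W := by
      have := W.sub_mem hvW (hU₁W (hdec v hvU))
      convert this using 1
      abel
    have hxyW : x ∈ W ∧ y ∈ W := by
      have hcancel : ∀ (t : ℚ) (z : V), t ≠ 0 → t • z ∈ W → z ∈ W := by
        intro t z ht hz
        have := W.smul_mem t⁻¹ hz
        rwa [smul_smul, inv_mul_cancel₀ ht, one_smul] at this
      rcases hu3 (φ 0) with h | h | h <;> rw [h] at huW hv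
      · refine ⟨huW, hcancel (ω x v / ω x y) y (div_ne_zero hv hxy) ?_⟩
        have := W.sub_mem hcomb (W.smul_mem (-(ω y v) / ω x y) huW)
        simpa using this
      · refine ⟨hcancel (-(ω y v) / ω x y) x (div_ne_zero (neg_ne_zero.mpr hv) hxy) ?_, huW⟩
        have := W.sub_mem hcomb (W.smul_mem (ω x v / ω x y) huW)
        simpa using this
      · have hy' : y ∈ W := by
          refine hcancel ((ω x v - ω y v) / ω x y) y
            (div_ne_zero (by simpa using hv) hxy) ?_
          have := W.sub_mem hcomb (W.smul_mem (-(ω y v) / ω x y) huW)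
          convert this using 1
          rw [smul_sub, sub_div, sub_smul, neg_div, neg_smul]
          module
        refine ⟨?_, hy'⟩
        have := W.add_mem huW hy'
        simpa using this
    intro v' hv'
    rw [show v' = (v' - (-(ω y v') / ω x y) • x - (ω x v' / ω x y) • y) +
        ((-(ω y v') / ω x y) • x + (ω x v' / ω x y) • y) by abel]
    exact W.add_mem (hU₁W (hdec v' hv'))
      (W.add_mem (W.smul_mem _ hxyW.1) (W.smul_mem _ hxyW.2))

/-- Hyperbolic data for a form. -/
structure FqHyp {V : Type} [AddCommGroup V] [Module ℚ V] (ω : V →ₗ[ℚ] V →ₗ[ℚ] ℚ)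
    (d : Σ n : ℕ, (Fin n → V) × (Fin n → V)) : Prop where
  xx : ∀ i j, ω (d.2.1 i) (d.2.1 j) = 0
  yy : ∀ i j, ω (d.2.2 i) (d.2.2 j) = 0
  xy : ∀ i j, i ≠ j → ω (d.2.1 i) (d.2.2 j) = 0
  ne : ∀ i, ω (d.2.1 i) (d.2.2 i) ≠ 0
  span : LinearMap.ker ω ⊔ Submodule.span ℚ (Set.range d.2.1) ⊔
    Submodule.span ℚ (Set.range d.2.2) = ⊤

/-- The critical subspaces. -/
def fqM {V : Type} [AddCommGroup V] [Module ℚ V] (ω : V →ₗ[ℚ] V →ₗ[ℚ] ℚ)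
    (d : Σ n : ℕ, (Fin n → V) × (Fin n → V)) (φ : Fin d.1 → Fin 3) : Submodule ℚ V :=
  LinearMap.ker ω ⊔ Submodule.span ℚ (Set.range (fqU d.2.1 d.2.2 φ))

theorem fq_transverse {V J : Type} [AddCommGroup V] [Module ℚ V] [FiniteDimensional ℚ V]
    [Fintype J] (ω : J → V →ₗ[ℚ] V →ₗ[ℚ] ℚ) (hω : ∀ k v, ω k v v = 0) :
    ∃ d : J → (Σ n : ℕ, (Fin n → V) × (Fin n → V)), (∀ k, FqHyp (ω k) (d k)) ∧
      ∀ k l, k ≠ l → ∀ φ ψ, fqM (ω k) (d k) φ ⊔ fqM (ω l) (d l) ψ = ⊤ := by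
  classical
  let rad : J → ℕ := fun k => Module.finrank ℚ (LinearMap.ker (ω k))
  suffices h : ∀ s : Finset J, ∃ d : J → (Σ n : ℕ, (Fin n → V) × (Fin n → V)),
      (∀ k ∈ s, FqHyp (ω k) (d k) ∧ 2 * (d k).1 + rad k ≤ Module.finrank ℚ V) ∧
      ∀ k ∈ s, ∀ l ∈ s, k ≠ l → ∀ φ ψ, fqM (ω k) (d k) φ ⊔ fqM (ω l) (d l) ψ = ⊤ by
    obtain ⟨d, h1, h2⟩ := h Finset.univ
    exact ⟨d, fun k => (h1 k (Finset.mem_univ _)).1,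
      fun k l => h2 k (Finset.mem_univ _) l (Finset.mem_univ _)⟩
  intro s
  induction s using Finset.induction_on_max_value (fun k => OrderDual.toDual (rad k)) with
  | empty => exact ⟨fun _ => ⟨0, Fin.elim0, Fin.elim0⟩, by simp, by simp⟩
  | insert a s ha hmax ih =>
    obtain ⟨d, hd1, hd2⟩ := ih
    let 𝒩 : Set (Submodule ℚ V) := ⋃ l ∈ s, Set.range (fun ψ => fqM (ω l) (d l) ψ)
    have hdimM : ∀ l ∈ s, ∀ ψ, Module.finrank ℚ V + rad a ≤
        2 * Module.finrank ℚ (fqM (ω l) (d l) ψ) := by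
      intro l hl ψ
      have hrad : rad a ≤ rad l := hmax l hl
      obtain ⟨hh, hc⟩ := hd1 l hl
      let v : Fin (d l).1 → V := fun i => if ψ i = 1 then (d l).2.1 i else (d l).2.2 i
      have htop : fqM (ω l) (d l) ψ ⊔ Submodule.span ℚ (Set.range v) = ⊤ := by
        rw [eq_top_iff, ← hh.span]
        have hu : ∀ i, fqU (d l).2.1 (d l).2.2 ψ i ∈
            fqM (ω l) (d l) ψ ⊔ Submodule.span ℚ (Set.range v) := fun i =>
          Submodule.mem_sup_left (Submodule.mem_sup_right (Submodule.subset_span ⟨i, rfl⟩))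
        have hv : ∀ i, v i ∈ fqM (ω l) (d l) ψ ⊔ Submodule.span ℚ (Set.range v) := fun i =>
          Submodule.mem_sup_right (Submodule.subset_span ⟨i, rfl⟩)
        have hboth : ∀ i, (d l).2.1 i ∈ fqM (ω l) (d l) ψ ⊔ Submodule.span ℚ (Set.range v) ∧
            (d l).2.2 i ∈ fqM (ω l) (d l) ψ ⊔ Submodule.span ℚ (Set.range v) := by
          intro i
          have h1 := hu i
          have h2 := hv i
          simp only [fqU, v] at h1 h2
          by_cases c1 : ψ i = 1
          · rw [if_pos c1] at h2
            rw [if_neg (by rw [c1]; decide), if_pos c1] at h1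
            exact ⟨h2, h1⟩
          · rw [if_neg c1] at h2
            by_cases c0 : ψ i = 0
            · rw [if_pos c0] at h1
              exact ⟨h1, h2⟩
            · rw [if_neg c0, if_neg c1] at h1
              refine ⟨?_, h2⟩
              have := Submodule.add_mem _ h1 h2
              simpa using this
        refine sup_le (sup_le (le_sup_of_le_left le_sup_left) ?_) ?_
        · rw [Submodule.span_le]
          rintro _ ⟨i, rfl⟩
          exact (hboth i).1
        · rw [Submodule.span_le]
          rintro _ ⟨i, rfl⟩
          exact (hboth i).2
      have h1 := Submodule.finrank_add_le_finrank_add_finrank (fqM (ω l) (d l) ψ)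
        (Submodule.span ℚ (Set.range v))
      have h2 : Module.finrank ℚ (Submodule.span ℚ (Set.range v)) ≤ (d l).1 := by
        have := finrank_range_le_card (R := ℚ) v
        simpa [Set.finrank] using this
      rw [htop, finrank_top] at h1
      omega
    obtain ⟨n, x, y, -, -, hxx, hyy, hxy, hne, hspan, hcard, htr⟩ :=
      fq_lemmaH (ω a) (hω a) (LinearMap.ker (ω a)) (Module.finrank ℚ V) ⊤ (finrank_top _ _)
      (by
        intro v
        simp only [LinearMap.mem_ker, Submodule.mem_top, true_and, forall_const]
        constructor
        · intro h u; rw [h]; rfl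
        · intro h; ext u; exact h u) 𝒩
      (s.finite_toSet.biUnion fun l _ => Set.finite_range _)
      (by
        intro N hN
        simp only [𝒩, Set.mem_iUnion] at hN
        obtain ⟨l, hl, ψ, rfl⟩ := hN
        refine ⟨le_top, ?_⟩
        rw [finrank_top]
        exact hdimM l hl ψ)
    rw [finrank_top] at hcard
    have htr' : ∀ l ∈ s, ∀ φ ψ, fqM (ω a) ⟨n, x, y⟩ φ ⊔ fqM (ω l) (d l) ψ = ⊤ := by
      intro l hl φ ψ
      refine eq_top_iff.mpr (htr _ ?_ φ)
      simp only [𝒩, Set.mem_iUnion]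
      exact ⟨l, hl, ψ, rfl⟩
    have hs : ∀ k ∈ s, Function.update d a ⟨n, x, y⟩ k = d k := by
      intro k hk
      have hka : k ≠ a := fun h => ha (h ▸ hk)
      exact Function.update_of_ne hka _ _
    have hself : Function.update d a ⟨n, x, y⟩ a = ⟨n, x, y⟩ := Function.update_self _ _ _
    refine ⟨Function.update d a ⟨n, x, y⟩, ?_, ?_⟩
    · intro k hk
      rw [Finset.mem_insert] at hk
      rcases hk with rfl | hk
      · rw [hself]
        exact ⟨⟨hxx, hyy, hxy, hne, eq_top_iff.mpr hspan⟩, hcard⟩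
      · rw [hs k hk]
        exact hd1 k hk
    · intro k hk l hl hkl
      rw [Finset.mem_insert] at hk hl
      rcases hk with rfl | hk <;> rcases hl with rfl | hl
      · exact absurd rfl hkl
      · rw [hself, hs l hl]
        exact htr' l hl
      · rw [hself, hs k hk]
        intro φ ψ
        rw [sup_comm]
        exact htr' k hk ψ φ
      · rw [hs k hk, hs l hl]
        exact hd2 k hk l hl hkl


theorem fq_ext_hom {E : Type} [Group E] (K : Subgroup E) [K.Normal]
    (hK : ∀ g h : E, g * h * (h * g)⁻¹ ∈ K) (i : ℚ → E) (hi : ∀ s t, i (s + t) = i s * i t)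
    (hinj : ∀ s, i s ∈ K → s = 0) :
    ∃ F : E → ℚ, (∀ g h, F (g * h) = F g + F h) ∧ (∀ k ∈ K, F k = 0) ∧ ∀ s, F (i s) = s := by
  let : CommGroup (E ⧸ K) :=
    { (inferInstance : Group (E ⧸ K)) with
      mul_comm := by
        intro a b
        obtain ⟨a, rfl⟩ := QuotientGroup.mk_surjective a
        obtain ⟨b, rfl⟩ := QuotientGroup.mk_surjective b
        have := (QuotientGroup.eq_one_iff (N := K) _).mpr (hK a b)
        rw [QuotientGroup.mk_mul, QuotientGroup.mk_inv, mul_inv_eq_one] at this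
        simpa using this }
  let j : ℚ →+ Additive (E ⧸ K) :=
    AddMonoidHom.mk' (fun s => Additive.ofMul (i s : E ⧸ K)) (by
      intro s t
      rw [hi]
      rfl)
  have hj : Function.Injective j := by
    rw [injective_iff_map_eq_zero]
    intro s hs
    apply hinj
    exact (QuotientGroup.eq_one_iff (N := K) _).mp hs
  obtain ⟨h, hh⟩ := (Module.Baer.of_divisible ℚ).extension_property_addMonoidHom j hj
    (AddMonoidHom.id ℚ)
  refine ⟨fun g => h (Additive.ofMul (g : E ⧸ K)), ?_, ?_, ?_⟩
  · intro a b
    rw [← map_add]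
    rfl
  · intro k hk
    have := (QuotientGroup.eq_one_iff (N := K) k).mpr hk
    simp only [this]
    exact map_zero h
  · intro s
    exact DFunLike.congr_fun hh s

/-- Carrier of the auxiliary central extension. -/
structure FqE (Q : Type) where
  g : Q
  s : ℚ

theorem fq_theta {Q V : Type} [Group Q] [AddCommGroup V] [Module ℚ V]
    (v : Q → V) (hv : ∀ p q, v (p * q) = v p + v q)
    (hvz : ∀ z ∈ Subgroup.center Q, v z = 0)
    (h2 : ∀ p q : Q, ⁅p, q⁆ ∈ Subgroup.center Q)
    (lam : Q → ℤ) (hlam : ∀ z ∈ Subgroup.center Q, ∀ z' ∈ Subgroup.center Q,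
      lam (z * z') = lam z + lam z')
    (β : V →ₗ[ℚ] V →ₗ[ℚ] ℚ)
    (hβ : ∀ p q, (lam ⁅p, q⁆ : ℚ) = β (v p) (v q) - β (v q) (v p)) :
    ∃ θ : Q → ℚ, (∀ g h, θ (g * h) = θ g + θ h + β (v g) (v h)) ∧
      ∀ z ∈ Subgroup.center Q, θ z = lam z := by
  have hv1 : v 1 = 0 := hvz 1 (one_mem _)
  have hvinv : ∀ p, v p⁻¹ = - v p := by
    intro p
    have := hv p p⁻¹
    rw [mul_inv_cancel, hv1] at this
    exact (neg_eq_of_add_eq_zero_right this.symm).symm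
  have hlam1 : lam 1 = 0 := by
    have := hlam 1 (one_mem _) 1 (one_mem _)
    simpa using this
  have hlaminv : ∀ z ∈ Subgroup.center Q, lam z⁻¹ = - lam z := by
    intro z hz
    have := hlam z hz z⁻¹ (inv_mem hz)
    rw [mul_inv_cancel, hlam1] at this
    omega
  let : Mul (FqE Q) := ⟨fun a b => ⟨a.g * b.g, a.s + b.s - β (v a.g) (v b.g)⟩⟩
  let : One (FqE Q) := ⟨⟨1, 0⟩⟩
  let : Inv (FqE Q) := ⟨fun a => ⟨a.g⁻¹, -a.s - β (v a.g) (v a.g)⟩⟩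
  have mul_def : ∀ a b : FqE Q, a * b = ⟨a.g * b.g, a.s + b.s - β (v a.g) (v b.g)⟩ :=
    fun _ _ => rfl
  have one_def : (1 : FqE Q) = ⟨1, 0⟩ := rfl
  have inv_def : ∀ a : FqE Q, a⁻¹ = ⟨a.g⁻¹, -a.s - β (v a.g) (v a.g)⟩ := fun _ => rfl
  let : Group (FqE Q) := Group.ofLeftAxioms
    (by
      intro a b c
      simp only [mul_def, FqE.mk.injEq, mul_assoc, hv, map_add, LinearMap.add_apply, true_and]
      ring)
    (by intro a; simp [mul_def, one_def, hv1])
    (by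
      intro a
      simp only [mul_def, one_def, inv_def, inv_mul_cancel, hvinv, map_neg, LinearMap.neg_apply,
        FqE.mk.injEq, true_and]
      ring)
  let K : Subgroup (FqE Q) :=
    { carrier := {a | a.g ∈ Subgroup.center Q ∧ a.s = - lam a.g}
      mul_mem' := by
        rintro a b ⟨ha, ha'⟩ ⟨hb, hb'⟩
        refine ⟨mul_mem ha hb, ?_⟩
        rw [mul_def]
        simp only [ha', hb', hlam _ ha _ hb, hvz _ ha]
        push_cast
        simp only [map_zero, LinearMap.zero_apply]
        ring
      one_mem' := ⟨one_mem _, by simp [one_def, hlam1]⟩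
      inv_mem' := by
        rintro a ⟨ha, ha'⟩
        refine ⟨inv_mem ha, ?_⟩
        have := hlaminv _ ha
        rw [inv_def]
        simp [ha', this, hvz _ ha] }
  have hKmem : ∀ a, a ∈ K ↔ a.g ∈ Subgroup.center Q ∧ a.s = - lam a.g := fun _ => Iff.rfl
  have hKc : ∀ a ∈ K, ∀ b, b * a = a * b := by
    intro a ha b
    obtain ⟨h1, h3⟩ := (hKmem a).mp ha
    simp only [mul_def, hvz _ h1, map_zero, LinearMap.zero_apply, FqE.mk.injEq]
    exact ⟨Subgroup.mem_center_iff.mp h1 _, by ring⟩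
  have : K.Normal := ⟨by
    intro n hn g
    rw [hKc n hn g, mul_inv_cancel_right]
    exact hn⟩
  obtain ⟨F, hF1, hF2, hF3⟩ := fq_ext_hom K (by
    intro g h
    have key : g * h = ⟨⁅g.g, h.g⁆, -(lam ⁅g.g, h.g⁆ : ℚ)⟩ * (h * g) := by
      have e1 : ⁅g.g, h.g⁆ * (h.g * g.g) = g.g * h.g := by
        rw [commutatorElement_def]; group
      simp only [mul_def, e1, hvz _ (h2 g.g h.g), map_zero, LinearMap.zero_apply, hβ,
        FqE.mk.injEq, true_and]
      ring
    rw [key, mul_inv_cancel_right]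
    exact ⟨h2 _ _, rfl⟩) (fun s => ⟨1, s⟩) (by
    intro s t
    simp [mul_def, hv1]) (by
    rintro s ⟨_, h⟩
    simpa [hlam1] using h)
  refine ⟨fun g => F ⟨g, 0⟩, ?_, ?_⟩
  · intro g h
    have e1 : (⟨g, 0⟩ : FqE Q) * ⟨h, 0⟩ = ⟨g * h, 0⟩ * ⟨1, -β (v g) (v h)⟩ := by
      simp [mul_def, hv1]
    have := congrArg F e1
    rw [hF1, hF1, hF3] at this
    simp only
    linarith
  · intro z hz
    have e1 : (⟨z, 0⟩ : FqE Q) = ⟨z, -(lam z : ℚ)⟩ * ⟨1, (lam z : ℚ)⟩ := by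
      simp [mul_def, hv1]
    simp only
    rw [e1, hF1, hF3, hF2 _ ⟨hz, rfl⟩, zero_add]

theorem fq_f (e : ℚ) (he : e ≠ 0) : ∃ f : ℚ → ℝ, f 0 = 1 ∧
    ∀ s : ℚ, f (s + 1) = ((2 : ℝ) ^ ((e * s : ℚ) : ℝ) - 1) * f s := by
  classical
  let g : ℕ → ℝ := fun n => ∏ j ∈ Finset.range n, ((2 : ℝ) ^ ((e * (-(j + 1 : ℕ)) : ℚ) : ℝ) - 1)⁻¹
  let f : ℚ → ℝ := fun s => if h : ∃ n : ℕ, s = -(n : ℚ) then g h.choose else 0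
  have hf : ∀ n : ℕ, f (-(n : ℚ)) = g n := by
    intro n
    have h : ∃ k : ℕ, -(n : ℚ) = -(k : ℚ) := ⟨n, rfl⟩
    simp only [f, dif_pos h]
    congr 1
    have := h.choose_spec
    have h3 := neg_injective this
    exact_mod_cast h3.symm
  have hf0 : ∀ s : ℚ, (¬ ∃ n : ℕ, s = -(n : ℚ)) → f s = 0 := fun s h => by
    simp only [f, dif_neg h]
  refine ⟨f, ?_, ?_⟩
  · have := hf 0
    simpa [g] using this
  · intro s
    by_cases h : ∃ n : ℕ, s = -(n : ℚ)
    · obtain ⟨n, rfl⟩ := h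
      cases n with
      | zero =>
        have : f (-((0 : ℕ) : ℚ) + 1) = 0 := by
          apply hf0
          rintro ⟨k, hk⟩
          have : (0 : ℚ) ≤ k := Nat.cast_nonneg k
          simp at hk
          linarith
        rw [this]
        simp
      | succ n =>
        rw [show -((n + 1 : ℕ) : ℚ) + 1 = -(n : ℚ) by push_cast; ring, hf, hf]
        have hne : (2 : ℝ) ^ ((e * (-(n + 1 : ℕ)) : ℚ) : ℝ) - 1 ≠ 0 := by
          intro h
          have h1 : (2 : ℝ) ^ ((e * (-(n + 1 : ℕ)) : ℚ) : ℝ) = 1 := by linarith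
          have h2 : ((e * (-(n + 1 : ℕ)) : ℚ) : ℝ) = 0 := by
            have h5 := congrArg Real.log h1
            rw [Real.log_rpow (by norm_num), Real.log_one] at h5
            exact (mul_eq_zero.mp h5).resolve_right (Real.log_pos (by norm_num)).ne' 
          have h3 : (e * (-(n + 1 : ℕ)) : ℚ) = 0 := by exact_mod_cast h2
          have h4 : (-((n + 1 : ℕ) : ℚ)) ≠ 0 := by
            rw [neg_ne_zero]; exact_mod_cast Nat.succ_ne_zero n
          exact (mul_ne_zero he h4) h3
        simp only [g]
        rw [Finset.prod_range_succ]
        rw [mul_comm (∏ x ∈ _, _), mul_inv_cancel_left₀ hne]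
    · rw [hf0 s h, mul_zero]
      apply hf0
      rintro ⟨k, hk⟩
      exact h ⟨k + 1, by push_cast; linarith⟩

/-- The half of the form determined by hyperbolic data. -/
noncomputable def fqBeta {V : Type} [AddCommGroup V] [Module ℚ V] (ω : V →ₗ[ℚ] V →ₗ[ℚ] ℚ)
    {n : ℕ} (x y : Fin n → V) : V →ₗ[ℚ] V →ₗ[ℚ] ℚ :=
  ∑ i, (ω (x i) (y i))⁻¹ • (ω.flip (y i)).smulRight (ω (x i))

theorem fqBeta_apply {V : Type} [AddCommGroup V] [Module ℚ V] (ω : V →ₗ[ℚ] V →ₗ[ℚ] ℚ)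
    {n : ℕ} (x y : Fin n → V) (u v : V) :
    fqBeta ω x y u v = ∑ i, (ω (x i) (y i))⁻¹ * (ω u (y i) * ω (x i) v) := by
  simp [fqBeta, LinearMap.sum_apply]

theorem fqBeta_skew {V : Type} [AddCommGroup V] [Module ℚ V] (ω : V →ₗ[ℚ] V →ₗ[ℚ] ℚ)
    (hω : ∀ v, ω v v = 0) (d : Σ n : ℕ, (Fin n → V) × (Fin n → V)) (hd : FqHyp ω d) (u v : V) :
    fqBeta ω d.2.1 d.2.2 u v - fqBeta ω d.2.1 d.2.2 v u = ω u v := by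
  obtain ⟨n, x, y⟩ := d
  have hxx := hd.xx
  have hyy := hd.yy
  have hxy := hd.xy
  have hne := hd.ne
  have hspan := hd.span
  simp only at hxx hyy hxy hne hspan ⊢
  have hsk : ∀ u v, ω u v = - ω v u := by
    intro u v
    have h := hω (u + v)
    simp only [map_add, LinearMap.add_apply, hω] at h
    linarith
  let γ : V →ₗ[ℚ] V →ₗ[ℚ] ℚ := fqBeta ω x y - (fqBeta ω x y).flip - ω
  have hγ : ∀ u v, γ u v = fqBeta ω x y u v - fqBeta ω x y v u - ω u v := fun u v => by
    simp [γ]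
  have hγsk : ∀ u v, γ u v = - γ v u := by
    intro u v
    rw [hγ, hγ, hsk v u]; ring
  -- values of beta
  have b1 : ∀ i v, fqBeta ω x y (x i) v = ω (x i) v := by
    intro i v
    rw [fqBeta_apply, Finset.sum_eq_single i]
    · rw [inv_mul_cancel_left₀ (hne i)]
    · intro j _ hj
      rw [hxy i j (Ne.symm hj)]; ring
    · simp
  have b2 : ∀ i u, fqBeta ω x y u (x i) = 0 := by
    intro i u
    rw [fqBeta_apply]
    exact Finset.sum_eq_zero fun j _ => by rw [hxx]; ring
  have b3 : ∀ i v, fqBeta ω x y (y i) v = 0 := by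
    intro i v
    rw [fqBeta_apply]
    exact Finset.sum_eq_zero fun j _ => by rw [hyy]; ring
  have b4 : ∀ i u, fqBeta ω x y u (y i) = ω u (y i) := by
    intro i u
    rw [fqBeta_apply, Finset.sum_eq_single i]
    · rw [mul_comm (ω u (y i)), inv_mul_cancel_left₀ (hne i)]
    · intro j _ hj
      rw [hxy j i hj]; ring
    · simp
  have g1 : ∀ i v, γ (x i) v = 0 := by
    intro i v; rw [hγ, b1, b2]; ring
  have g2 : ∀ i v, γ (y i) v = 0 := by
    intro i v; rw [hγ, b3, b4, hsk (y i)]; ring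
  have g3 : ∀ w ∈ LinearMap.ker ω, ∀ v, γ w v = 0 := by
    intro w hw v
    have hw' : ∀ v, ω w v = 0 := fun v => by
      rw [LinearMap.mem_ker] at hw; rw [hw]; rfl
    have hw'' : ∀ v, ω v w = 0 := fun v => by rw [hsk, hw', neg_zero]
    rw [hγ, fqBeta_apply, fqBeta_apply]
    simp [hw', hw'']
  have hker : LinearMap.ker γ = ⊤ := by
    rw [eq_top_iff, ← hspan]
    refine sup_le (sup_le ?_ ?_) ?_
    · intro w hw
      rw [LinearMap.mem_ker]
      ext v; exact g3 w hw v
    · rw [Submodule.span_le]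
      rintro _ ⟨i, rfl⟩
      rw [SetLike.mem_coe, LinearMap.mem_ker]
      ext v; exact g1 i v
    · rw [Submodule.span_le]
      rintro _ ⟨i, rfl⟩
      rw [SetLike.mem_coe, LinearMap.mem_ker]
      ext v; exact g2 i v
  have hz : γ u = 0 := by
    have : u ∈ LinearMap.ker γ := by rw [hker]; trivial
    exact this
  have := hγ u v
  rw [hz] at this
  simp at this
  linarith

theorem fq_lemmaB {Q : Type} [Group Q] {m : ℕ}
    (π : Q → Fin m → ℤ) (hπ : ∀ p q, π (p * q) = π p + π q) (hπs : Function.Surjective π)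
    (hπz : ∀ z ∈ Subgroup.center Q, π z = 0)
    (h2 : ∀ p q : Q, ⁅p, q⁆ ∈ Subgroup.center Q)
    (lam : Q → ℤ) (hlam : ∀ z ∈ Subgroup.center Q, ∀ z' ∈ Subgroup.center Q,
      lam (z * z') = lam z + lam z')
    (hlams : ∀ t : ℤ, ∃ z ∈ Subgroup.center Q, lam z = t)
    (ω : (Fin m → ℚ) →ₗ[ℚ] (Fin m → ℚ) →ₗ[ℚ] ℚ) (hω : ∀ v, ω v v = 0)
    (hωl : ∀ p q, (lam ⁅p, q⁆ : ℚ) = ω (fun i => (π p i : ℚ)) (fun i => (π q i : ℚ)))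
    (n : ℕ) (x y : Fin n → Fin m → ℚ) (hd : FqHyp ω ⟨n, x, y⟩)
    {J : Type} (dd : J → Fin m → ℚ) (hdd : ∀ j, ω (dd j) = 0) :
    ∃ (C : Fin n → ℚ) (X Y : Fin n → Q) (C' : J → ℚ) (d' : J → Q) (b : Q → ℝ),
      (∀ i, 0 < C i) ∧ (∀ j, 0 < C' j) ∧
      (∀ i, (fun t => (π (X i) t : ℚ)) = C i • x i) ∧
      (∀ i, (fun t => (π (Y i) t : ℚ)) = C i • y i) ∧
      (∀ j, (fun t => (π (d' j) t : ℚ)) = C' j • dd j) ∧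
      b 1 = 1 ∧ (∀ g, ∀ z ∈ Subgroup.center Q, b (g * z) = (2 : ℝ) ^ (lam z) * b g) ∧
      (∀ g j, b (g * d' j) = b g) ∧ (∀ g i, b (g * Y i) = b g + b (g * X i)) := by
  classical
  let v : Q → Fin m → ℚ := fun q i => (π q i : ℚ)
  have hv : ∀ p q, v (p * q) = v p + v q := by
    intro p q; ext i; simp [v, hπ]
  have hvz : ∀ z ∈ Subgroup.center Q, v z = 0 := by
    intro z hz; ext i; simp [v, hπz z hz]
  have hv1 : v 1 = 0 := hvz 1 (one_mem _)
  have hvpow : ∀ p (k : ℕ), v (p ^ k) = (k : ℚ) • v p := by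
    intro p k
    induction k with
    | zero => simp [hv1]
    | succ k ih => rw [pow_succ, hv, ih]; push_cast; rw [add_smul, one_smul]
  have hxx := hd.xx
  have hyy := hd.yy
  have hxy := hd.xy
  have hne := hd.ne
  simp only at hxx hyy hxy hne
  have hsk : ∀ u v, ω u v = - ω v u := by
    intro u v
    have h := hω (u + v)
    simp only [map_add, LinearMap.add_apply, hω] at h
    linarith
  have hdd' : ∀ j u, ω u (dd j) = 0 := fun j u => by
    rw [hsk, hdd]; simp
  set β := fqBeta ω x y with hβdef
  have hβap : ∀ u v, β u v = ∑ i, (ω (x i) (y i))⁻¹ * (ω u (y i) * ω (x i) v) :=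
    fqBeta_apply ω x y
  have hβskew : ∀ u v, β u v - β v u = ω u v := fqBeta_skew ω hω ⟨n, x, y⟩ hd
  obtain ⟨θ, hθ, hθz⟩ := fq_theta v hv hvz h2 lam hlam β (fun p q => by
    rw [hβskew]; exact hωl p q)
  have b2 : ∀ i u, β u (x i) = 0 := by
    intro i u
    rw [hβap]
    exact Finset.sum_eq_zero fun j _ => by rw [hxx]; ring
  have b3 : ∀ i v, β (y i) v = 0 := by
    intro i v
    rw [hβap]
    exact Finset.sum_eq_zero fun j _ => by rw [hyy]; ring
  have b4 : ∀ i u, β u (y i) = ω u (y i) := by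
    intro i u
    rw [hβap, Finset.sum_eq_single i]
    · rw [mul_comm (ω u (y i)), inv_mul_cancel_left₀ (hne i)]
    · intro j _ hj
      rw [hxy j i hj]; ring
    · simp
  have b5 : ∀ j u, β u (dd j) = 0 := by
    intro j u
    rw [hβap]
    exact Finset.sum_eq_zero fun i _ => by rw [hdd']; ring
  have hlift : ∀ u : Fin m → ℚ, β u u = 0 → ∃ c : ℕ, 0 < c ∧ ∀ k : ℕ, 0 < k →
      ∃ X : Q, v X = ((c * k : ℕ) : ℚ) • u ∧ θ X = 0 := by
    intro u hu
    obtain ⟨c₀, hc₀, p, hp⟩ : ∃ c₀ : ℕ, 0 < c₀ ∧ ∃ p : Q, v p = (c₀ : ℚ) • u := by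
      let c₀ : ℕ := ∏ i, (u i).den
      have hexi : ∀ i, ∃ a : ℤ, (a : ℚ) = (c₀ : ℚ) * u i := by
        intro i
        obtain ⟨k, hk⟩ : (u i).den ∣ c₀ := Finset.dvd_prod_of_mem _ (Finset.mem_univ i)
        refine ⟨k * (u i).num, ?_⟩
        rw [hk]
        push_cast
        have := Rat.mul_den_eq_num (u i)
        rw [← this]; ring
      choose a ha using hexi
      obtain ⟨p, hp⟩ := hπs a
      refine ⟨c₀, Finset.prod_pos fun i _ => (u i).den_pos, p, ?_⟩
      ext i
      simp only [v, hp, ha, Pi.smul_apply, smul_eq_mul]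
    have hpow : ∀ (q : Q) (t : ℚ), v q = t • u → ∀ k : ℕ, θ (q ^ k) = k * θ q := by
      intro q t hq k
      induction k with
      | zero =>
        have := hθ 1 1
        rw [hv1] at this
        simp at this
        simp [this]
      | succ k ih =>
        rw [pow_succ, hθ, ih, hvpow, hq]
        simp only [map_smul, LinearMap.smul_apply, hu, smul_zero]
        push_cast; ring
    obtain ⟨z, hz, hlz⟩ := hlams (-(θ p).num)
    refine ⟨c₀ * (θ p).den, Nat.mul_pos hc₀ (θ p).den_pos, fun k hk => ?_⟩
    have hX0v : v (p ^ (θ p).den * z) = ((c₀ * (θ p).den : ℕ) : ℚ) • u := by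
      rw [hv, hvz z hz, hvpow, hp, smul_smul]; push_cast; rw [add_zero, mul_comm]
    have hX0θ : θ (p ^ (θ p).den * z) = 0 := by
      rw [hθ, hvz z hz, hpow p _ hp, hθz z hz, hlz]
      have := Rat.mul_den_eq_num (θ p)
      push_cast
      rw [map_zero, ← this]; ring
    refine ⟨(p ^ (θ p).den * z) ^ k, ?_, ?_⟩
    · rw [hvpow, hX0v, smul_smul]; push_cast; congr 1; ring
    · rw [hpow _ _ hX0v, hX0θ, mul_zero]
  choose cx hcx hX using fun i => hlift (x i) (b2 i _)
  choose cy hcy hY using fun i => hlift (y i) (b3 i _)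
  choose cd hcd hD using fun j => hlift (dd j) (b5 j _)
  choose X hXv hXθ using fun i => hX i (cy i) (hcy i)
  choose Y hYv hYθ using fun i => hY i (cx i) (hcx i)
  choose d' hdv hdθ using fun j => hD j 1 one_pos
  let C : Fin n → ℚ := fun i => ((cx i * cy i : ℕ) : ℚ)
  have hC : ∀ i, 0 < C i := fun i => by
    have := Nat.mul_pos (hcx i) (hcy i)
    exact Nat.cast_pos.mpr this
  have hYv' : ∀ i, v (Y i) = C i • y i := fun i => by rw [hYv, mul_comm (cy i)]
  let e : Fin n → ℚ := fun i => C i ^ 2 * ω (x i) (y i)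
  have he : ∀ i, e i ≠ 0 := fun i => mul_ne_zero (pow_ne_zero _ (hC i).ne') (hne i)
  choose f hf0 hf1 using fun i => fq_f (e i) (he i)
  let α : Fin n → (Fin m → ℚ) → ℚ := fun i u => ω u (y i) / (C i * ω (x i) (y i))
  have hα : ∀ i u w, α i (u + w) = α i u + α i w := by
    intro i u w
    simp only [α, map_add, LinearMap.add_apply, add_div]
  let b : Q → ℝ := fun g => (2 : ℝ) ^ ((θ g : ℚ) : ℝ) * ∏ i, f i (α i (v g))
  have hθ1 : θ 1 = 0 := by
    have := hθ 1 1
    rw [hv1] at this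
    simpa using this
  have two_pos' : (0 : ℝ) < 2 := by norm_num
  refine ⟨C, X, Y, fun j => ((cd j * 1 : ℕ) : ℚ), d', b, hC, ?_, hXv, hYv', hdv, ?_, ?_, ?_, ?_⟩
  · intro j
    have := hcd j
    simp only [mul_one]
    exact_mod_cast this
  · simp [b, hθ1, hv1, α, hf0]
  · intro g z hz
    have h3 : v (g * z) = v g := by rw [hv, hvz z hz, add_zero]
    have h4 : θ (g * z) = θ g + lam z := by rw [hθ, hvz z hz, hθz z hz]; simp
    simp only [b, h3, h4]
    push_cast
    rw [Real.rpow_add two_pos', Real.rpow_intCast]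
    ring
  · intro g j
    have h3 : ∀ i, α i (v (g * d' j)) = α i (v g) := by
      intro i
      rw [hv, hα, hdv]
      simp [α, hdd]
    have h4 : θ (g * d' j) = θ g := by
      rw [hθ, hdθ, hdv, map_smul, b5]; simp
    simp only [b, h3, h4]
  · intro g i
    have h3 : ∀ k, k ≠ i → α k (v (g * X i)) = α k (v g) := by
      intro k hk
      rw [hv, hα, hXv]
      simp [α, hxy i k (Ne.symm hk)]
    have h3' : α i (v (g * X i)) = α i (v g) + 1 := by
      rw [hv, hα, hXv]
      congr 1
      simp only [α, map_smul, LinearMap.smul_apply, smul_eq_mul]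
      exact div_self (mul_ne_zero (hC i).ne' (hne i))
    have h4 : θ (g * X i) = θ g := by
      rw [hθ, hXθ, hXv, map_smul, b2]; simp
    have h5 : ∀ k, α k (v (g * Y i)) = α k (v g) := by
      intro k
      rw [hv, hα, hYv]
      simp [α, hyy]
    have h6 : θ (g * Y i) = θ g + e i * α i (v g) := by
      rw [hθ, hYθ, hYv', map_smul, b4, smul_eq_mul]
      simp only [e, α]
      have := hne i
      have := (hC i).ne'
      field_simp
      ring
    have hprod : ∏ k, f k (α k (v (g * X i))) =
        ((2 : ℝ) ^ ((e i * α i (v g) : ℚ) : ℝ) - 1) * ∏ k, f k (α k (v g)) := by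
      rw [← Finset.mul_prod_erase _ _ (Finset.mem_univ i),
        ← Finset.mul_prod_erase Finset.univ (fun k => f k (α k (v g))) (Finset.mem_univ i),
        h3', hf1, mul_assoc]
      congr 2
      refine Finset.prod_congr rfl fun k hk => ?_
      rw [h3 k (Finset.ne_of_mem_erase hk)]
    have hYb : b (g * Y i) = (2 : ℝ) ^ ((θ g : ℚ) : ℝ) *
        (2 : ℝ) ^ ((e i * α i (v g) : ℚ) : ℝ) * ∏ k, f k (α k (v g)) := by
      simp only [b, h5, h6]
      rw [Rat.cast_add, Real.rpow_add two_pos']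
    have hXb : b (g * X i) = (2 : ℝ) ^ ((θ g : ℚ) : ℝ) *
        (((2 : ℝ) ^ ((e i * α i (v g) : ℚ) : ℝ) - 1) * ∏ k, f k (α k (v g))) := by
      simp only [b, h4]
      rw [hprod]
    rw [hYb, hXb]
    simp only [b]
    ring

/-- A finitely generated abelian group maps onto some `ℤ^r` with finite kernel. -/
theorem fq_fgab {A : Type*} [CommGroup A] (hA : Group.FG A) :
    ∃ (r : ℕ) (f : A → Fin r → ℤ), (∀ a b, f (a * b) = f a + f b) ∧ Function.Surjective f ∧
      {a | f a = 0}.Finite := by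
  have : AddGroup.FG (Additive A) := inferInstance
  obtain ⟨n, ι, _, p, hp, e, ⟨E⟩⟩ := AddCommGroup.equiv_free_prod_directSum_zmod (Additive A)
  refine ⟨n, fun a i => (E (Additive.ofMul a)).1 i, ?_, ?_, ?_⟩
  · intro a b
    ext i
    simp
  · intro t
    refine ⟨(E.symm (Finsupp.equivFunOnFinite.symm t, 0)).toMul, ?_⟩
    ext i
    simp
  · have : ∀ i, NeZero (p i ^ e i) := fun i => ⟨pow_ne_zero _ (hp i).ne_zero⟩
    have hfin : Finite (DirectSum ι fun i => ZMod (p i ^ e i)) := by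
      classical
      exact Finite.of_injective (fun x i => x i) (fun x y h => DFinsupp.ext fun i => congrFun h i)
    refine Set.Finite.of_finite_image (f := fun a => (E (Additive.ofMul a)).2) (Set.toFinite _) ?_
    intro a ha b hb hab
    have h1 : (E (Additive.ofMul a)).1 = (E (Additive.ofMul b)).1 := by
      ext i
      exact (congrFun ha i).trans (congrFun hb i).symm
    have h2 := E.injective (Prod.ext h1 hab)
    exact Additive.ofMul.injective h2

theorem fq_center_fg {Q : Type*} [Group Q] (hQ : Group.FG Q)
    (h2 : ∀ p q : Q, ⁅p, q⁆ ∈ Subgroup.center Q) (H : Subgroup Q) (hH : H ≤ Subgroup.center Q) :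
    ∃ S : Set Q, S.Finite ∧ Subgroup.closure S = H := by
  have hfp : Group.IsFinitelyPresented (Q ⧸ Subgroup.center Q) := by
    apply fq_fp_class_two inferInstance
    intro a b
    obtain ⟨a, rfl⟩ := QuotientGroup.mk'_surjective _ a
    obtain ⟨b, rfl⟩ := QuotientGroup.mk'_surjective _ b
    rw [← map_commutatorElement]
    rw [show (QuotientGroup.mk' (Subgroup.center Q)) ⁅a, b⁆ = 1 from
      (QuotientGroup.eq_one_iff _).mpr (h2 a b)]
    exact one_mem _
  obtain ⟨S, hS, hSq⟩ := fq_ker_fng (QuotientGroup.mk' (Subgroup.center Q))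
    (QuotientGroup.mk'_surjective _)
  rw [QuotientGroup.ker_mk'] at hSq
  have hle : Subgroup.closure S ≤ Subgroup.center Q := by
    rw [Subgroup.closure_le]
    intro s hs
    rw [← hSq]
    exact Subgroup.subset_normalClosure hs
  have hnorm : (Subgroup.closure S).Normal := by
    constructor
    intro x hx g
    have := Subgroup.mem_center_iff.mp (hle hx) g
    rw [this]
    simpa using hx
  have hcl : Subgroup.center Q = Subgroup.closure S := by
    apply le_antisymm _ hle
    rw [← hSq]
    exact Subgroup.normalClosure_le_normal Subgroup.subset_closure
  have hfg : Group.FG (Subgroup.center Q) := by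
    rw [Group.fg_iff_subgroup_fg, Subgroup.fg_iff]
    exact ⟨S, hcl.symm, hS⟩
  let _ : CommGroup (Subgroup.center Q) :=
    { (inferInstance : Group (Subgroup.center Q)) with
      mul_comm := fun a b => Subtype.ext (Subgroup.mem_center_iff.mp b.2 a) }
  obtain ⟨T, hT⟩ := fq_sub_fg (A := Subgroup.center Q) hfg (H.subgroupOf (Subgroup.center Q))
  refine ⟨(Subgroup.center Q).subtype '' T, T.finite_toSet.image _, ?_⟩
  rw [← MonoidHom.map_closure, hT, Subgroup.subgroupOf_map_subtype]
  exact inf_eq_left.mpr hH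

theorem fq_data {Q : Type*} [Group Q] (hQ : Group.FG Q)
    (h2 : ∀ p q : Q, ⁅p, q⁆ ∈ Subgroup.center Q) :
    ∃ (m r N : ℕ) (π : Q → Fin m → ℤ) (lam : Q → Fin r → ℤ), 0 < N ∧
      (∀ p q, π (p * q) = π p + π q) ∧ Function.Surjective π ∧
      (∀ z ∈ Subgroup.center Q, π z = 0) ∧
      (∀ q, π q = 0 → q ^ N ∈ Subgroup.center Q) ∧
      (∀ z ∈ Subgroup.center Q, ∀ z' ∈ Subgroup.center Q, lam (z * z') = lam z + lam z') ∧
      (∀ t, ∃ z ∈ Subgroup.center Q, lam z = t) ∧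
      (∀ z ∈ Subgroup.center Q, lam z = 0 → z ^ N = 1) ∧
      (∃ B : Set Q, B.Finite ∧ ∀ q, π q = 0 → ∃ b ∈ B, ∃ z ∈ Subgroup.center Q, q = b * z) ∧
      (∃ B : Set Q, B.Finite ∧ ∀ z ∈ Subgroup.center Q, ∃ b ∈ B, ∃ y ∈ Subgroup.center Q,
        z = b * y ^ N) := by
  classical
  have hcomm : ∀ a b : Q ⧸ Subgroup.center Q, a * b = b * a := by
    intro a b
    obtain ⟨a, rfl⟩ := QuotientGroup.mk'_surjective _ a
    obtain ⟨b, rfl⟩ := QuotientGroup.mk'_surjective _ b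
    rw [← commutatorElement_eq_one_iff_mul_comm, ← map_commutatorElement]
    exact (QuotientGroup.eq_one_iff _).mpr (h2 a b)
  let _ : CommGroup (Q ⧸ Subgroup.center Q) :=
    { (inferInstance : Group (Q ⧸ Subgroup.center Q)) with mul_comm := hcomm }
  obtain ⟨m, π0, hπ0, hπs, hπf⟩ := fq_fgab (A := Q ⧸ Subgroup.center Q) inferInstance
  have hZfg : Group.FG (Subgroup.center Q) := by
    obtain ⟨S, hS, h⟩ := fq_center_fg hQ h2 _ le_rfl
    rw [Group.fg_iff_subgroup_fg, Subgroup.fg_iff]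
    exact ⟨S, h, hS⟩
  let _ : CommGroup (Subgroup.center Q) :=
    { (inferInstance : Group (Subgroup.center Q)) with
      mul_comm := fun a b => Subtype.ext (Subgroup.mem_center_iff.mp b.2 a) }
  obtain ⟨r, l0, hl0, hls, hlf⟩ := fq_fgab (A := Subgroup.center Q) hZfg
  let P : (Q ⧸ Subgroup.center Q) →* Multiplicative (Fin m → ℤ) :=
    MonoidHom.mk' (fun a => Multiplicative.ofAdd (π0 a)) (fun a b => by rw [hπ0]; rfl)
  let L : (Subgroup.center Q) →* Multiplicative (Fin r → ℤ) :=
    MonoidHom.mk' (fun a => Multiplicative.ofAdd (l0 a)) (fun a b => by rw [hl0]; rfl)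
  have hP1 : ∀ a, a ∈ P.ker ↔ π0 a = 0 := fun a => Iff.rfl
  have hL1 : ∀ a, a ∈ L.ker ↔ l0 a = 0 := fun a => Iff.rfl
  have hPfin : Finite P.ker := hπf
  have hLfin : Finite L.ker := hlf
  set N := Nat.card P.ker * Nat.card L.ker with hN
  have hNpos : 0 < N := Nat.mul_pos Nat.card_pos Nat.card_pos
  have hPN : ∀ a, π0 a = 0 → a ^ N = 1 := by
    intro a ha
    have := pow_card_eq_one' (x := (⟨a, ha⟩ : P.ker))
    have h' : a ^ Nat.card P.ker = 1 := congrArg Subtype.val this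
    rw [hN, pow_mul, h', one_pow]
  have hLN : ∀ a, l0 a = 0 → a ^ N = 1 := by
    intro a ha
    have := pow_card_eq_one' (x := (⟨a, ha⟩ : L.ker))
    have h' : a ^ Nat.card L.ker = 1 := congrArg Subtype.val this
    rw [hN, mul_comm, pow_mul, h', one_pow]
  refine ⟨m, r, N, fun q => π0 (QuotientGroup.mk' _ q),
    fun z => if h : z ∈ Subgroup.center Q then l0 ⟨z, h⟩ else 0, hNpos, ?_, ?_, ?_, ?_, ?_, ?_,
    ?_, ?_, ?_⟩
  · intro p q
    simp only [map_mul, hπ0]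
  · exact hπs.comp (QuotientGroup.mk'_surjective _)
  · intro z hz
    have h1 : QuotientGroup.mk' (Subgroup.center Q) z = 1 := (QuotientGroup.eq_one_iff _).mpr hz
    show π0 _ = 0
    rw [h1]
    exact (hP1 1).mp (one_mem _)
  · intro q hq
    have := hPN _ hq
    rw [← map_pow] at this
    exact (QuotientGroup.eq_one_iff _).mp this
  · intro z hz z' hz'
    simp only [hz, hz', mul_mem hz hz', dif_pos]
    exact hl0 ⟨z, hz⟩ ⟨z', hz'⟩
  · intro t
    obtain ⟨z, hz⟩ := hls t
    exact ⟨z, z.2, by simp [hz]⟩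
  · intro z hz h
    simp only [hz, dif_pos] at h
    exact congrArg Subtype.val (hLN _ h)
  · refine ⟨Quotient.out '' {a : Q ⧸ Subgroup.center Q | π0 a = 0}, hπf.image _, ?_⟩
    intro q hq
    refine ⟨_, ⟨_, hq, rfl⟩, (Quotient.out (QuotientGroup.mk' (Subgroup.center Q) q))⁻¹ * q, ?_,
      by group⟩
    rw [← QuotientGroup.eq]
    exact Quotient.out_eq _
  · -- quotient of the centre by N-th powers is finite
    let H : Subgroup (Subgroup.center Q) := (powMonoidHom N).range
    have : Finite (Subgroup.center Q ⧸ H) := by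
      apply CommGroup.finite_of_fg_isMulTorsion
      intro a
      obtain ⟨a, rfl⟩ := QuotientGroup.mk'_surjective _ a
      rw [isOfFinOrder_iff_pow_eq_one]
      refine ⟨N, hNpos, ?_⟩
      rw [← map_pow]
      exact (QuotientGroup.eq_one_iff _).mpr ⟨a, rfl⟩
    refine ⟨Set.range fun a : Subgroup.center Q ⧸ H => ((Quotient.out a : Subgroup.center Q) : Q),
      Set.finite_range _, ?_⟩
    intro z hz
    have h1 : (Quotient.out (QuotientGroup.mk' H ⟨z, hz⟩))⁻¹ * ⟨z, hz⟩ ∈ H := by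
      rw [← QuotientGroup.eq]
      exact Quotient.out_eq _
    obtain ⟨y, hy⟩ := h1
    refine ⟨_, ⟨QuotientGroup.mk' H ⟨z, hz⟩, rfl⟩, y, y.2, ?_⟩
    have h2 : y ^ N = (Quotient.out (QuotientGroup.mk' H ⟨z, hz⟩))⁻¹ * ⟨z, hz⟩ := hy
    have h3 := congrArg Subtype.val h2
    simp only [Subgroup.coe_mul, Subgroup.coe_inv, Subgroup.coe_pow] at h3
    rw [h3]; group

theorem fq_swap_pow {Q : Type*} [Group Q] {a b c : Q} (hc : c ∈ Subgroup.center Q)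
    (h : b * a = a * b * c) (n : ℕ) : b ^ n * a = a * b ^ n * c ^ n := by
  have hc' := Subgroup.mem_center_iff.mp hc
  induction n with
  | zero => simp
  | succ n ih =>
    have h1 : Commute c (b ^ n) := (hc' (b ^ n)).symm
    rw [pow_succ b, mul_assoc, h, ← mul_assoc, ← mul_assoc, ih, pow_succ c]
    have h2 : Commute b (c ^ n) := Commute.pow_right (hc' b) n
    rw [mul_assoc _ (c ^ n) b, ← h2.eq]
    simp only [mul_assoc]

theorem fq_mul_pow {Q : Type*} [Group Q] {a b c : Q} (hc : c ∈ Subgroup.center Q)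
    (h : b * a = a * b * c) (n : ℕ) : (a * b) ^ n = a ^ n * b ^ n * c ^ (n.choose 2) := by
  have hc' := Subgroup.mem_center_iff.mp hc
  induction n with
  | zero => simp
  | succ n ih =>
    have h2 : Commute (a * b) (c ^ n.choose 2) := Commute.pow_right (hc' _) _
    have h3 : Commute b (c ^ n) := Commute.pow_right (hc' b) n
    rw [pow_succ, ih, mul_assoc _ (c ^ _), ← h2.eq, Nat.choose_succ_succ' n 1, Nat.choose_one_right]
    calc a ^ n * b ^ n * (a * b * c ^ n.choose 2)
        = a ^ n * (b ^ n * a) * b * c ^ n.choose 2 := by simp only [mul_assoc]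
      _ = a ^ n * (a * b ^ n) * (c ^ n * b) * c ^ n.choose 2 := by
        rw [fq_swap_pow hc h]; simp only [mul_assoc]
      _ = _ := by
        rw [← h3.eq, pow_succ' a, (Commute.refl a).pow_right n |>.eq, pow_succ b]
        simp only [mul_assoc, pow_add]

/-- Additivity on the centre, as powers. -/
theorem fq_lam_pow {Q : Type*} [Group Q] {r : ℕ} {lam : Q → Fin r → ℤ}
    (hlam : ∀ z ∈ Subgroup.center Q, ∀ z' ∈ Subgroup.center Q, lam (z * z') = lam z + lam z')
    {z : Q} (hz : z ∈ Subgroup.center Q) (n : ℕ) : lam (z ^ n) = n • lam z := by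
  have h1 : lam 1 = 0 := by
    have := hlam 1 (one_mem _) 1 (one_mem _)
    simpa using this
  induction n with
  | zero => simp [h1]
  | succ n ih => rw [pow_succ, hlam _ (pow_mem hz n) _ hz, ih, succ_nsmul]

theorem fq_lam_zpow {Q : Type*} [Group Q] {r : ℕ} {lam : Q → Fin r → ℤ}
    (hlam : ∀ z ∈ Subgroup.center Q, ∀ z' ∈ Subgroup.center Q, lam (z * z') = lam z + lam z')
    {z : Q} (hz : z ∈ Subgroup.center Q) (n : ℤ) : lam (z ^ n) = n • lam z := by
  have h1 : lam 1 = 0 := by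
    have := hlam 1 (one_mem _) 1 (one_mem _)
    simpa using this
  obtain ⟨n, rfl | rfl⟩ := n.eq_nat_or_neg
  · rw [zpow_natCast, fq_lam_pow hlam hz, natCast_zsmul]
  · have h2 := hlam (z ^ n) (pow_mem hz n) (z ^ (-(n : ℤ))) (zpow_mem hz _)
    rw [zpow_neg, zpow_natCast, mul_inv_cancel, h1, fq_lam_pow hlam hz] at h2
    rw [zpow_neg, zpow_natCast, neg_smul, natCast_zsmul]
    exact (neg_eq_of_add_eq_zero_right h2.symm).symm

theorem fq_pi_pow {Q : Type*} [Group Q] {m : ℕ} {π : Q → Fin m → ℤ}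
    (hπ : ∀ p q, π (p * q) = π p + π q) (q : Q) (n : ℕ) : π (q ^ n) = n • π q := by
  have h1 : π 1 = 0 := by
    have := hπ 1 1
    simpa using this
  induction n with
  | zero => simp [h1]
  | succ n ih => rw [pow_succ, hπ, ih, succ_nsmul]

theorem fq_K {Q : Type*} [Group Q] (h2 : ∀ p q : Q, ⁅p, q⁆ ∈ Subgroup.center Q)
    {m r N : ℕ} {π : Q → Fin m → ℤ} {lam : Q → Fin r → ℤ} (hN : 0 < N)
    (hπ : ∀ p q, π (p * q) = π p + π q)
    (hπz : ∀ z ∈ Subgroup.center Q, π z = 0)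
    (hπN : ∀ q, π q = 0 → q ^ N ∈ Subgroup.center Q)
    (hlam : ∀ z ∈ Subgroup.center Q, ∀ z' ∈ Subgroup.center Q, lam (z * z') = lam z + lam z')
    (hlN : ∀ z ∈ Subgroup.center Q, lam z = 0 → z ^ N = 1) :
    ∃ K : Subgroup Q, (∀ q, q ^ (2 * N ^ 2) ∈ K) ∧ (∀ z ∈ Subgroup.center Q, z ^ N ∈ K) ∧
      ∀ z ∈ Subgroup.center Q, z ∈ K → lam z = 0 → z = 1 := by
  have hM : (2 * N ^ 2).choose 2 = N * (N * (2 * N ^ 2 - 1)) := by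
    rw [Nat.choose_two_right]
    apply Nat.div_eq_of_eq_mul_right two_pos
    ring
  have hcz : ∀ z ∈ Subgroup.center Q, ∀ q : Q, Commute q z := fun z hz q =>
    Subgroup.mem_center_iff.mp hz q
  let K : Subgroup Q :=
    { carrier := {g | ∃ q, ∃ z ∈ Subgroup.center Q, g = q ^ (2 * N ^ 2) * z ^ N}
      mul_mem' := by
        rintro _ _ ⟨a, y, hy, rfl⟩ ⟨b, z, hz, rfl⟩
        have hc : ⁅b⁻¹, a⁻¹⁆ ∈ Subgroup.center Q := h2 _ _
        set c := ⁅b⁻¹, a⁻¹⁆ with hcdef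
        have hba : b * a = a * b * c := by rw [hcdef, commutatorElement_def]; group
        have h := fq_mul_pow hc hba (2 * N ^ 2)
        rw [hM, mul_comm N (N * _), pow_mul c] at h
        set c' := c ^ (N * (2 * N ^ 2 - 1)) with hc'
        have hc'z : c' ∈ Subgroup.center Q := pow_mem hc _
        refine ⟨a * b, c'⁻¹ * (y * z), mul_mem (inv_mem hc'z) (mul_mem hy hz), ?_⟩
        rw [h, (hcz _ (mul_mem hy hz) (c'⁻¹)).mul_pow, (hcz _ hz y).mul_pow, inv_pow]
        have e1 : Commute (b ^ (2 * N ^ 2)) (y ^ N) := hcz _ (pow_mem hy N) _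
        calc a ^ (2 * N ^ 2) * y ^ N * (b ^ (2 * N ^ 2) * z ^ N)
            = a ^ (2 * N ^ 2) * (y ^ N * b ^ (2 * N ^ 2)) * z ^ N := by simp only [mul_assoc]
          _ = a ^ (2 * N ^ 2) * (b ^ (2 * N ^ 2) * y ^ N) * z ^ N := by rw [e1.eq]
          _ = _ := by group
      one_mem' := ⟨1, 1, one_mem _, by simp⟩
      inv_mem' := by
        rintro _ ⟨a, y, hy, rfl⟩
        refine ⟨a⁻¹, y⁻¹, inv_mem hy, ?_⟩
        rw [mul_inv_rev, inv_pow, inv_pow]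
        exact (hcz _ (inv_mem (pow_mem hy N)) _).symm.eq }
  refine ⟨K, fun q => ⟨q, 1, one_mem _, by simp⟩, fun z hz => ⟨1, z, hz, by simp⟩, ?_⟩
  rintro g hg ⟨q, z, hz, rfl⟩ hl
  have h1 := hπz _ hg
  rw [hπ, hπz _ (pow_mem hz N), add_zero, fq_pi_pow hπ] at h1
  have h3 : π q = 0 := by
    rcases smul_eq_zero.mp h1 with h | h
    · have : 0 < 2 * N ^ 2 := by positivity
      omega
    · exact h
  have hy := hπN q h3
  set y := q ^ N with hydef
  have hq : q ^ (2 * N ^ 2) = (y ^ 2) ^ N := by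
    rw [hydef, ← pow_mul, ← pow_mul]; congr 1; ring
  rw [hq, ← (hcz z hz _).mul_pow] at hl ⊢
  have hyz : y ^ 2 * z ∈ Subgroup.center Q := mul_mem (pow_mem hy 2) hz
  rw [fq_lam_pow hlam hyz] at hl
  apply hlN _ hyz
  rcases smul_eq_zero.mp hl with h | h
  · omega
  · exact h

/-- A homomorphism to the integers trivial on the centre factors through `π`. -/
theorem fq_factor {Q : Type*} [Group Q]
    {m N : ℕ} {π : Q → Fin m → ℤ} (hN : 0 < N)
    (hπ : ∀ p q, π (p * q) = π p + π q) (g : Fin m → Q)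
    (hπs : Function.Surjective π)
    (hg : ∀ i, π (g i) = Pi.single i 1)
    (hπN : ∀ q, π q = 0 → q ^ N ∈ Subgroup.center Q) (f : Q → ℤ)
    (hf : ∀ p q, f (p * q) = f p + f q) (hfz : ∀ z ∈ Subgroup.center Q, f z = 0) (p : Q) :
    f p = ∑ i, π p i * f (g i) := by
  have hf1 : f 1 = 0 := hfz 1 (one_mem _)
  have hπ1 : π 1 = 0 := by
    have := hπ 1 1
    simpa using this
  have hfpow : ∀ q (n : ℕ), f (q ^ n) = n * f q := by
    intro q n
    induction n with
    | zero => simp [hf1]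
    | succ n ih => rw [pow_succ, hf, ih]; push_cast; ring
  have hker : ∀ q, π q = 0 → f q = 0 := by
    intro q hq
    have h1 := hfz _ (hπN q hq)
    rw [hfpow] at h1
    rcases mul_eq_zero.mp h1 with h | h
    · exact absurd (by exact_mod_cast h) hN.ne'
    · exact h
  have hdep : ∀ p q, π p = π q → f p = f q := by
    intro p q h
    have e1 : π (p * q⁻¹) = 0 := by
      have a1 := hπ (p * q⁻¹) q
      rw [inv_mul_cancel_right, h] at a1
      simpa using a1
    have e2 := hf (p * q⁻¹) q
    rw [inv_mul_cancel_right, hker _ e1, zero_add] at e2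
    exact e2
  choose s hs using hπs
  let F : (Fin m → ℤ) →+ ℤ := AddMonoidHom.mk' (fun t => f (s t)) (by
    intro a b
    rw [← hf]
    apply hdep
    rw [hπ, hs, hs, hs])
  have h1 := LinearMap.pi_apply_eq_sum_univ F.toIntLinearMap (π p)
  have h2 : F.toIntLinearMap (π p) = f p := hdep _ _ (hs _)
  rw [h2] at h1
  rw [h1]
  refine Finset.sum_congr rfl fun i _ => ?_
  have h3 : F.toIntLinearMap (fun j => if i = j then 1 else 0) = f (g i) := by
    apply hdep
    rw [hs, hg]
    ext j
    simp [Pi.single_apply, eq_comm]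
  rw [h3, smul_eq_mul]

theorem fq_omega {Q : Type*} [Group Q] (h2 : ∀ p q : Q, ⁅p, q⁆ ∈ Subgroup.center Q)
    {m N : ℕ} {π : Q → Fin m → ℤ} {lam : Q → ℤ} (hN : 0 < N)
    (hπ : ∀ p q, π (p * q) = π p + π q) (hπs : Function.Surjective π)
    (hπN : ∀ q, π q = 0 → q ^ N ∈ Subgroup.center Q)
    (hlam : ∀ z ∈ Subgroup.center Q, ∀ z' ∈ Subgroup.center Q, lam (z * z') = lam z + lam z') :
    ∃ ω : (Fin m → ℚ) →ₗ[ℚ] (Fin m → ℚ) →ₗ[ℚ] ℚ, (∀ v, ω v v = 0) ∧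
      ∀ p q, (lam ⁅p, q⁆ : ℚ) = ω (fun i => (π p i : ℚ)) (fun i => (π q i : ℚ)) := by
  classical
  have hl1 : lam 1 = 0 := by
    have := hlam 1 (one_mem _) 1 (one_mem _)
    simpa using this
  have hcz : ∀ p q g : Q, Commute g ⁅p, q⁆ := fun p q g =>
    Subgroup.mem_center_iff.mp (h2 p q) g
  have hbl : ∀ p q s : Q, ⁅p * q, s⁆ = ⁅p, s⁆ * ⁅q, s⁆ := by
    intro p q s
    have h := (hcz q s p).eq
    calc ⁅p * q, s⁆ = p * ⁅q, s⁆ * s * p⁻¹ * s⁻¹ := by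
          simp only [commutatorElement_def]; group
      _ = ⁅q, s⁆ * p * s * p⁻¹ * s⁻¹ := by rw [h]
      _ = ⁅q, s⁆ * ⁅p, s⁆ := by simp only [commutatorElement_def]; group
      _ = _ := (hcz p s ⁅q, s⁆).eq
  have hskew : ∀ p q : Q, lam ⁅p, q⁆ = - lam ⁅q, p⁆ := by
    intro p q
    have := hlam _ (h2 p q) _ (h2 q p)
    rw [← commutatorElement_inv p q, mul_inv_cancel, hl1, commutatorElement_inv] at this
    linarith
  choose g hg using fun i : Fin m => hπs (Pi.single i 1)
  have hc1 : ∀ p s, lam ⁅p, s⁆ = ∑ i, π p i * lam ⁅g i, s⁆ := by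
    intro p s
    apply fq_factor hN hπ g hπs hg hπN (fun p => lam ⁅p, s⁆)
    · intro p q
      rw [hbl, hlam _ (h2 _ _) _ (h2 _ _)]
    · intro z hz
      have : ⁅z, s⁆ = 1 := by
        rw [commutatorElement_eq_one_iff_mul_comm]
        exact (Subgroup.mem_center_iff.mp hz s).symm
      rw [this, hl1]
  have hc2 : ∀ p s, lam ⁅p, s⁆ = ∑ i, ∑ j, π p i * (π s j * lam ⁅g i, g j⁆) := by
    intro p s
    rw [hc1]
    refine Finset.sum_congr rfl fun i _ => ?_
    rw [hskew, hc1 s, ← Finset.mul_sum, ← Finset.sum_neg_distrib]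
    congr 1
    refine Finset.sum_congr rfl fun j _ => ?_
    rw [hskew (g i) (g j)]; ring
  let A : Matrix (Fin m) (Fin m) ℚ := fun i j => (lam ⁅g i, g j⁆ : ℚ)
  have hA : ∀ u v, Matrix.toLinearMap₂' ℚ A u v = ∑ i, ∑ j, u i * (v j * A i j) := by
    intro u v
    rw [Matrix.toLinearMap₂'_apply]
    simp [smul_eq_mul]
  refine ⟨Matrix.toLinearMap₂' ℚ A, ?_, ?_⟩
  · intro v
    have h1 : ∑ i, ∑ j, v i * (v j * A i j) = ∑ i, ∑ j, -(v i * (v j * A i j)) := by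
      rw [Finset.sum_comm]
      refine Finset.sum_congr rfl fun i _ => Finset.sum_congr rfl fun j _ => ?_
      have : A j i = - A i j := by
        simp only [A]
        rw [hskew]; push_cast; ring
      rw [this]; ring
    simp only [Finset.sum_neg_distrib] at h1
    rw [hA]
    linarith
  · intro p q
    rw [hA, hc2]
    push_cast
    rfl

/-- The real-valued functional on `ℚ^m` given by a real vector. -/
noncomputable def fqL {m : ℕ} (χ : Fin m → ℝ) : (Fin m → ℚ) →ₗ[ℚ] ℝ where
  toFun u := χ ⬝ᵥ fun i => (u i : ℝ)
  map_add' u v := by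
    simp only [dotProduct, Pi.add_apply, Rat.cast_add, mul_add, Finset.sum_add_distrib]
  map_smul' c u := by
    simp only [dotProduct, Pi.smul_apply, smul_eq_mul, Rat.cast_mul, RingHom.id_apply,
      Rat.smul_def, Finset.mul_sum]
    refine Finset.sum_congr rfl fun i _ => ?_
    ring

theorem fqL_int {m : ℕ} (χ : Fin m → ℝ) (t : Fin m → ℤ) :
    (χ ⬝ᵥ fun i => (t i : ℝ)) = fqL χ (fun i => (t i : ℚ)) := by
  simp [fqL]

theorem fqL_neg {m : ℕ} (χ : Fin m → ℝ) (u : Fin m → ℚ) : fqL (-χ) u = - fqL χ u := by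
  simp [fqL]

theorem fqL_eq_zero {m : ℕ} (χ : Fin m → ℝ) (h : LinearMap.ker (fqL χ) = ⊤) : χ = 0 := by
  classical
  ext i
  have h1 : fqL χ (Pi.single i 1) = 0 := by
    rw [← LinearMap.mem_ker, h]; trivial
  have h2 : (fun j => (((Pi.single i 1 : Fin m → ℚ) j : ℚ) : ℝ)) = Pi.single i 1 := by
    ext j
    rcases eq_or_ne j i with rfl | hj
    · simp
    · simp [hj]
  have h3 : fqL χ (Pi.single i 1) = χ ⬝ᵥ fun j => (((Pi.single i 1 : Fin m → ℚ) j : ℚ) : ℝ) := rfl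
  rw [h3, h2] at h1
  simpa using h1

theorem fq_nopos {Q : Type} [Group Q] {m : ℕ} (π : Q → Fin m → ℤ)
    (hπ : ∀ p q, π (p * q) = π p + π q) (χ : Fin m → ℝ)
    (ω : (Fin m → ℚ) →ₗ[ℚ] (Fin m → ℚ) →ₗ[ℚ] ℚ)
    (n : ℕ) (x y : Fin n → Fin m → ℚ) {J : Type} (dd : J → Fin m → ℚ)
    (hdd : Submodule.span ℚ (Set.range dd) = LinearMap.ker ω)
    (C : Fin n → ℚ) (X Y : Fin n → Q) (C' : J → ℚ) (d' : J → Q)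
    (hC : ∀ i, 0 < C i) (hC' : ∀ j, 0 < C' j)
    (hX : ∀ i, (fun t => (π (X i) t : ℚ)) = C i • x i)
    (hY : ∀ i, (fun t => (π (Y i) t : ℚ)) = C i • y i)
    (hd' : ∀ j, (fun t => (π (d' j) t : ℚ)) = C' j • dd j)
    (St : Set Q) (Pr : Set (Q × Q)) (hSt : ∀ j, d' j ∈ St) (hPr : ∀ i, (X i, Y i) ∈ Pr)
    (h : ∀ p ∈ fqMoves St Pr, ¬ (0 < (χ ⬝ᵥ fun i => (π p.1 i : ℝ)) ∧
      0 < (χ ⬝ᵥ fun i => (π p.2 i : ℝ)))) :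
    LinearMap.ker ω ≤ LinearMap.ker (fqL χ) ∧ ∀ i,
      ¬ (0 < fqL χ (x i) ∧ 0 < fqL χ (y i)) ∧
      ¬ (fqL χ (y i) < 0 ∧ fqL χ (y i) < fqL χ (x i)) ∧
      ¬ (fqL χ (x i) < 0 ∧ fqL χ (x i) < fqL χ (y i)) := by
  let v : Q → ℝ := fun q => χ ⬝ᵥ fun i => (π q i : ℝ)
  have hv : ∀ p q, v (p * q) = v p + v q := by
    intro p q
    simp only [v, hπ, dotProduct, Pi.add_apply, Int.cast_add, mul_add, Finset.sum_add_distrib]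
  have hv1 : v 1 = 0 := by
    have := hv 1 1
    simpa using this
  have hvinv : ∀ p, v p⁻¹ = - v p := by
    intro p
    have := hv p p⁻¹
    rw [mul_inv_cancel, hv1] at this
    linarith
  replace h : ∀ p ∈ fqMoves St Pr, ¬ (0 < v p.1 ∧ 0 < v p.2) := h
  have hvX : ∀ i, v (X i) = C i * fqL χ (x i) := by
    intro i
    simp only [v]
    rw [fqL_int, hX, map_smul, Rat.smul_def]
  have hvY : ∀ i, v (Y i) = C i * fqL χ (y i) := by
    intro i
    simp only [v]
    rw [fqL_int, hY, map_smul, Rat.smul_def]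
  have hvd : ∀ j, v (d' j) = C' j * fqL χ (dd j) := by
    intro j
    simp only [v]
    rw [fqL_int, hd', map_smul, Rat.smul_def]
  constructor
  · rw [← hdd, Submodule.span_le]
    rintro _ ⟨j, rfl⟩
    rw [SetLike.mem_coe, LinearMap.mem_ker]
    have h1 := h (d' j, d' j) (Or.inl (Or.inl (Or.inl (Or.inl ⟨_, hSt j, rfl⟩))))
    have h2 := h ((d' j)⁻¹, (d' j)⁻¹) (Or.inl (Or.inl (Or.inl (Or.inr ⟨_, hSt j, rfl⟩))))
    simp only [hvinv, and_self, not_lt] at h1 h2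
    have h3 : v (d' j) = 0 := by linarith
    rw [hvd] at h3
    have h4 : ((C' j : ℚ) : ℝ) ≠ 0 := by exact_mod_cast (hC' j).ne'
    exact (mul_eq_zero.mp h3).resolve_left h4
  · intro i
    have hCi : (0 : ℝ) < C i := by exact_mod_cast hC i
    have h1 := h (X i, Y i) (Or.inl (Or.inl (Or.inr (hPr i))))
    have h2 := h ((Y i)⁻¹, (Y i)⁻¹ * X i) (Or.inl (Or.inr ⟨_, hPr i, rfl⟩))
    have h3 := h ((X i)⁻¹, (X i)⁻¹ * Y i) (Or.inr ⟨_, hPr i, rfl⟩)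
    simp only [hv, hvinv, hvX, hvY] at h1 h2 h3
    refine ⟨fun h' => h1 ⟨mul_pos hCi h'.1, mul_pos hCi h'.2⟩, fun h' => h2 ⟨?_, ?_⟩,
      fun h' => h3 ⟨?_, ?_⟩⟩ <;> nlinarith

theorem fq_nopos_M {m : ℕ} (χ : Fin m → ℝ)
    (ω : (Fin m → ℚ) →ₗ[ℚ] (Fin m → ℚ) →ₗ[ℚ] ℚ)
    (d : Σ n : ℕ, (Fin n → Fin m → ℚ) × (Fin n → Fin m → ℚ))
    (h : LinearMap.ker ω ≤ LinearMap.ker (fqL χ) ∧ ∀ i,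
      ¬ (0 < fqL χ (d.2.1 i) ∧ 0 < fqL χ (d.2.2 i)) ∧
      ¬ (fqL χ (d.2.2 i) < 0 ∧ fqL χ (d.2.2 i) < fqL χ (d.2.1 i)) ∧
      ¬ (fqL χ (d.2.1 i) < 0 ∧ fqL χ (d.2.1 i) < fqL χ (d.2.2 i))) :
    ∃ φ, fqM ω d φ ≤ LinearMap.ker (fqL χ) := by
  have h1 : ∀ i, ∃ a : Fin 3, fqL χ (if a = 0 then d.2.1 i else if a = 1 then d.2.2 i
      else d.2.1 i - d.2.2 i) = 0 := by
    intro i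
    obtain ⟨h1, h2, h3⟩ := h.2 i
    by_cases hx : fqL χ (d.2.1 i) = 0
    · exact ⟨0, by simpa using hx⟩
    by_cases hy : fqL χ (d.2.2 i) = 0
    · exact ⟨1, by simpa using hy⟩
    refine ⟨2, ?_⟩
    have : fqL χ (d.2.1 i) - fqL χ (d.2.2 i) = 0 := by
      by_contra hne
      rcases lt_or_gt_of_ne hx with hx | hx <;> rcases lt_or_gt_of_ne hy with hy | hy <;>
        rcases lt_or_gt_of_ne hne with hn | hn
      · exact h3 ⟨hx, by linarith⟩
      · exact h2 ⟨hy, by linarith⟩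
      · exact h3 ⟨hx, by linarith⟩
      · exact h3 ⟨hx, by linarith⟩
      · exact h2 ⟨hy, by linarith⟩
      · exact h2 ⟨hy, by linarith⟩
      · exact h1 ⟨hx, hy⟩
      · exact h1 ⟨hx, hy⟩
    simpa using this
  choose φ hφ using h1
  refine ⟨φ, sup_le h.1 ?_⟩
  rw [Submodule.span_le]
  rintro _ ⟨i, rfl⟩
  exact hφ i


theorem fq_delta_unip {Q : Type} [Group Q] {z : Q} {N : ℕ} (hN : 0 < N) (hz : z ^ N = 1)
    (c : ℕ) : ∀ v : Q → ℝ, (fqDelta z)^[c] v = 0 → fqDelta z v = 0 := by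
  have key : ∀ v : Q → ℝ, fqDelta z (fqDelta z v) = 0 → fqDelta z v = 0 := by
    intro v hv
    have h1 : ∀ g, fqDelta z v (g * z) = fqDelta z v g := by
      intro g
      have := congrFun hv g
      simp only [fqDelta, Pi.zero_apply] at this ⊢
      linarith
    have h2 : ∀ g (n : ℕ), v (g * z ^ n) = v g + n * fqDelta z v g := by
      intro g n
      induction n generalizing g with
      | zero => simp
      | succ n ih =>
        rw [pow_succ', ← mul_assoc, ih, h1]
        simp only [fqDelta]
        push_cast
        ring
    ext g
    have h3 := h2 g N
    rw [hz, mul_one] at h3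
    have h4 : (N : ℝ) * fqDelta z v g = 0 := by linarith
    have h5 : (N : ℝ) ≠ 0 := by exact_mod_cast hN.ne'
    exact (mul_eq_zero.mp h4).resolve_left h5
  induction c with
  | zero =>
    intro v hv
    have : v = 0 := hv
    subst this
    ext g
    simp [fqDelta]
  | succ c ih =>
    intro v hv
    rw [Function.iterate_succ_apply] at hv
    exact key _ (ih _ hv)

theorem fq_delta_scale {Q : Type} [Group Q] {z : Q} {b : Q → ℝ} {s : ℝ} (hs : s ≠ 1)
    (hb : ∀ g, b (g * z) = s * b g) (hb1 : b 1 = 1) (c : ℕ) : (fqDelta z)^[c] b ≠ 0 := by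
  have h : ∀ c g, (fqDelta z)^[c] b g = (s - 1) ^ c * b g := by
    intro c
    induction c with
    | zero => simp
    | succ c ih =>
      intro g
      rw [Function.iterate_succ_apply']
      simp only [fqDelta]
      rw [ih, ih, hb]
      ring
  intro h0
  have := h c 1
  rw [h0, hb1, mul_one] at this
  exact pow_ne_zero c (sub_ne_zero.mpr hs) this.symm

theorem fq_final {Q : Type} [Group Q] (hQ : Group.FG Q)
    (h2 : ∀ p q : Q, ⁅p, q⁆ ∈ Subgroup.center Q) :
    ∃ (n : ℕ) (rels : Set (FreeGroup (Fin n))), rels.Finite ∧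
      ∃ (A : Subgroup (PresentedGroup rels)) (φ : PresentedGroup rels →* Q),
        A.Normal ∧ (∀ a b : A, a * b = b * a) ∧
        (∀ N : Subgroup (PresentedGroup rels), N.Normal → Group.IsNilpotent N → N ≤ A) ∧
        Function.Surjective φ ∧ φ.ker = A := by
  classical
  obtain ⟨m, r, N, π, lam, hN, hπ, hπs, hπz, hπN, hlam, hlams, hlN, ⟨B1, hB1, hB1'⟩,
    ⟨B2, hB2, hB2'⟩⟩ := fq_data hQ h2
  have hπ1 : π 1 = 0 := hπz 1 (one_mem _)
  have hcz : ∀ z ∈ Subgroup.center Q, ∀ q : Q, Commute q z := fun z hz q =>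
    Subgroup.mem_center_iff.mp hz q
  have hlamk : ∀ k : Fin r, ∀ z ∈ Subgroup.center Q, ∀ z' ∈ Subgroup.center Q,
      lam (z * z') k = lam z k + lam z' k := by
    intro k z hz z' hz'
    rw [hlam z hz z' hz', Pi.add_apply]
  choose ω hω hωl using fun k : Fin r =>
    fq_omega (lam := fun z => lam z k) h2 hN hπ hπs hπN (hlamk k)
  obtain ⟨d, hd, htr⟩ := fq_transverse ω hω
  have hddex : ∀ k, ∃ (s : ℕ) (dd : Fin s → Fin m → ℚ),
      Submodule.span ℚ (Set.range dd) = LinearMap.ker (ω k) := fun k =>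
    Submodule.fg_iff_exists_fin_generating_family.mp (IsNoetherian.noetherian _)
  choose s dd hdd using hddex
  have hdd0 : ∀ k j, ω k (dd k j) = 0 := by
    intro k j
    rw [← LinearMap.mem_ker, ← hdd]
    exact Submodule.subset_span ⟨j, rfl⟩
  choose C X Y C' d' b hC hC' hX hY hd' hb1 hbz hbd hbp using fun k : Fin r =>
    fq_lemmaB π hπ hπs hπz h2 (fun z => lam z k) (hlamk k)
      (fun t => by
        obtain ⟨z, hz, h⟩ := hlams (fun _ => t)
        exact ⟨z, hz, by rw [h]⟩) (ω k) (hω k) (hωl k) (d k).1 (d k).2.1 (d k).2.2 (hd k)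
      (dd k) (hdd0 k)
  obtain ⟨K, hKM, hKN, hKT⟩ := fq_K h2 hN hπ hπz hπN hlam hlN
  obtain ⟨w0, hw0, hlw0⟩ := hlams (fun _ => 1)
  choose g hg using fun i : Fin m => hπs (Pi.single i 1)
  -- subgroups of N-th powers
  have hl1 : lam 1 = 0 := by
    have := hlam 1 (one_mem _) 1 (one_mem _)
    simpa using this
  have hlinv : ∀ z ∈ Subgroup.center Q, lam z⁻¹ = - lam z := by
    intro z hz
    have := fq_lam_zpow hlam hz (-1)
    simpa using this
  let Zp : Subgroup Q :=
    { carrier := {x | ∃ z ∈ Subgroup.center Q, x = z ^ N}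
      mul_mem' := by
        rintro _ _ ⟨y, hy, rfl⟩ ⟨z, hz, rfl⟩
        exact ⟨y * z, mul_mem hy hz, ((hcz z hz y).mul_pow N).symm⟩
      one_mem' := ⟨1, one_mem _, by simp⟩
      inv_mem' := by
        rintro _ ⟨y, hy, rfl⟩
        exact ⟨y⁻¹, inv_mem hy, by rw [inv_pow]⟩ }
  let H : Fin r → Subgroup Q := fun k =>
    { carrier := {x | ∃ z ∈ Subgroup.center Q, lam z k = 0 ∧ x = z ^ N}
      mul_mem' := by
        rintro _ _ ⟨y, hy, h1, rfl⟩ ⟨z, hz, h2, rfl⟩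
        exact ⟨y * z, mul_mem hy hz, by rw [hlamk k y hy z hz, h1, h2, add_zero],
          ((hcz z hz y).mul_pow N).symm⟩
      one_mem' := ⟨1, one_mem _, by rw [hl1]; rfl, by simp⟩
      inv_mem' := by
        rintro _ ⟨y, hy, h1, rfl⟩
        exact ⟨y⁻¹, inv_mem hy, by rw [hlinv y hy, Pi.neg_apply, h1, neg_zero],
          by rw [inv_pow]⟩ }
  have hHc : ∀ k, H k ≤ Subgroup.center Q := by
    rintro k _ ⟨z, hz, -, rfl⟩
    exact pow_mem hz N
  have hZc : Zp ≤ Subgroup.center Q := by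
    rintro _ ⟨z, hz, rfl⟩
    exact pow_mem hz N
  obtain ⟨SZ, hSZ, hSZc⟩ := fq_center_fg hQ h2 Zp hZc
  choose SH hSH hSHc using fun k => fq_center_fg hQ h2 (H k) (hHc k)
  have hwc : w0 ^ N ∈ Subgroup.center Q := pow_mem hw0 N
  let St : Option (Fin r) → Set Q := fun o =>
    o.elim (SZ ∪ Set.range fun i => g i ^ (2 * N ^ 2)) (fun k => SH k ∪ Set.range (d' k))
  let Pr : Option (Fin r) → Set (Q × Q) := fun o =>
    o.elim ∅ (fun k => Set.range fun i => (X k i, Y k i))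
  let e : Option (Fin r) → ℕ := fun o => o.elim 1 (fun _ => 2 ^ N)
  let b' : Option (Fin r) → Q → ℝ := fun o =>
    o.elim (fun q => if q ∈ K then 1 else 0) b
  have hStf : ∀ k, (St k).Finite := by
    rintro (_ | k)
    · exact hSZ.union (Set.finite_range _)
    · exact (hSH k).union (Set.finite_range _)
  have hPrf : ∀ k, (Pr k).Finite := by
    rintro (_ | k)
    · exact Set.finite_empty
    · exact Set.finite_range _
  -- the finiteness statement
  have hfin : ∀ R : ℝ, ∃ B : Set Q, B.Finite ∧ ∀ q, ‖fun i => (π q i : ℝ)‖ ≤ R →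
      ∃ b ∈ B, ∃ κ ∈ Zp, q = b * κ := by
    intro R
    choose sec hsec using hπs
    let T : Set (Fin m → ℤ) := Set.Icc (fun _ => -⌈|R|⌉) (fun _ => ⌈|R|⌉)
    have hT : T.Finite := Set.finite_Icc _ _
    refine ⟨(fun p : (Fin m → ℤ) × Q × Q => sec p.1 * p.2.1 * p.2.2) '' (T ×ˢ B1 ×ˢ B2),
      (hT.prod (hB1.prod hB2)).image _, ?_⟩
    intro q hq
    have hqT : π q ∈ T := by
      have h1 : ∀ i, |(π q i : ℝ)| ≤ ⌈|R|⌉ := by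
        intro i
        have h3 := norm_le_pi_norm (fun i => (π q i : ℝ)) i
        rw [Real.norm_eq_abs] at h3
        exact (h3.trans hq).trans ((le_abs_self R).trans (Int.le_ceil _))
      constructor <;> intro i
      · have := (abs_le.mp (h1 i)).1
        exact_mod_cast this
      · have := (abs_le.mp (h1 i)).2
        exact_mod_cast this
    have h0 : π ((sec (π q))⁻¹ * q) = 0 := by
      have h3 := hπ (sec (π q)) ((sec (π q))⁻¹ * q)
      rw [mul_inv_cancel_left, hsec] at h3
      simpa using h3
    obtain ⟨b1, hb1, z, hz, hbz⟩ := hB1' _ h0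
    obtain ⟨b2, hb2, y, hy, hby⟩ := hB2' z hz
    refine ⟨_, ⟨(π q, b1, b2), ⟨hqT, hb1, hb2⟩, rfl⟩, y ^ N, ⟨y, hy, rfl⟩, ?_⟩
    simp only [mul_assoc]
    rw [← hby, ← hbz]
    group
  have hκ : ∀ κ ∈ Zp, ∀ l, ∃ j : ℤ, ∃ κ₀ ∈ Subgroup.closure (St l), κ = (w0 ^ N) ^ j * κ₀ := by
    rintro _ ⟨z, hz, rfl⟩ (_ | k)
    · refine ⟨0, z ^ N, ?_, by simp⟩
      have h1 : z ^ N ∈ Subgroup.closure SZ := by rw [hSZc]; exact ⟨z, hz, rfl⟩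
      exact Subgroup.closure_mono Set.subset_union_left h1
    · have hy : w0 ^ (-lam z k) * z ∈ Subgroup.center Q := mul_mem (zpow_mem hw0 _) hz
      refine ⟨lam z k, (w0 ^ (-lam z k) * z) ^ N, ?_, ?_⟩
      · have h1 : (w0 ^ (-lam z k) * z) ^ N ∈ Subgroup.closure (SH k) := by
          rw [hSHc]
          refine ⟨_, hy, ?_, rfl⟩
          rw [hlamk k _ (zpow_mem hw0 _) _ hz, fq_lam_zpow hlam hw0, hlw0]
          simp
        exact Subgroup.closure_mono Set.subset_union_left h1
      · rw [(hcz z hz _).mul_pow, ← mul_assoc]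
        have : (w0 ^ N) ^ lam z k * (w0 ^ (-lam z k)) ^ N = 1 := by
          rw [← zpow_natCast, ← zpow_natCast, ← zpow_mul, ← zpow_mul, ← zpow_add]
          ring_nf
          simp
        rw [this, one_mul]
  -- moves for the first generator
  have hmove0 : ∀ χ : Fin m → ℝ, χ ≠ 0 → ∃ p ∈ fqMoves (St none) (Pr none),
      0 < (χ ⬝ᵥ fun i => (π p.1 i : ℝ)) ∧ 0 < (χ ⬝ᵥ fun i => (π p.2 i : ℝ)) := by
    intro χ hχ
    obtain ⟨i, hi⟩ := Function.ne_iff.mp hχ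
    have hM : (0 : ℝ) < 2 * N ^ 2 := by positivity
    have hc : (fun t => (π (g i ^ (2 * N ^ 2)) t : ℝ)) = (2 * N ^ 2 : ℝ) • Pi.single i 1 := by
      ext t
      rw [fq_pi_pow hπ, hg]
      rcases eq_or_ne t i with rfl | hj
      · simp
      · simp [hj]
    have hcinv : (fun t => (π ((g i ^ (2 * N ^ 2))⁻¹) t : ℝ)) =
        -(fun t => (π (g i ^ (2 * N ^ 2)) t : ℝ)) := by
      have h3 := hπ (g i ^ (2 * N ^ 2)) (g i ^ (2 * N ^ 2))⁻¹
      rw [mul_inv_cancel, hπ1] at h3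
      ext t
      have h4 := congrFun h3 t
      simp only [Pi.zero_apply, Pi.add_apply] at h4
      have h5 : π ((g i ^ (2 * N ^ 2))⁻¹) t = - π (g i ^ (2 * N ^ 2)) t := by omega
      rw [h5]
      simp
    have hmem : g i ^ (2 * N ^ 2) ∈ St none := Or.inr ⟨i, rfl⟩
    have hval : (χ ⬝ᵥ fun t => (π (g i ^ (2 * N ^ 2)) t : ℝ)) = 2 * N ^ 2 * χ i := by
      rw [hc, dotProduct_smul]; simp
    rcases lt_or_gt_of_ne hi with hi | hi
    · refine ⟨_, Or.inl (Or.inl (Or.inl (Or.inr ⟨_, hmem, rfl⟩))), ?_⟩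
      have hi' : χ i < 0 := hi
      simp only [hcinv, dotProduct_neg, hval, and_self]
      nlinarith
    · refine ⟨_, Or.inl (Or.inl (Or.inl (Or.inl ⟨_, hmem, rfl⟩))), ?_⟩
      have hi' : 0 < χ i := hi
      simp only [hval, and_self]
      positivity
  have hnp : ∀ (χ : Fin m → ℝ) (k : Fin r), (∀ p ∈ fqMoves (St (some k)) (Pr (some k)),
      ¬ (0 < (χ ⬝ᵥ fun i => (π p.1 i : ℝ)) ∧ 0 < (χ ⬝ᵥ fun i => (π p.2 i : ℝ)))) →
      LinearMap.ker (ω k) ≤ LinearMap.ker (fqL χ) ∧ ∀ i,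
      ¬ (0 < fqL χ ((d k).2.1 i) ∧ 0 < fqL χ ((d k).2.2 i)) ∧
      ¬ (fqL χ ((d k).2.2 i) < 0 ∧ fqL χ ((d k).2.2 i) < fqL χ ((d k).2.1 i)) ∧
      ¬ (fqL χ ((d k).2.1 i) < 0 ∧ fqL χ ((d k).2.1 i) < fqL χ ((d k).2.2 i)) := by
    intro χ k h
    exact fq_nopos π hπ χ (ω k) _ _ _ (dd k) (hdd k) (C k) (X k) (Y k) (C' k) (d' k) (hC k)
      (hC' k) (hX k) (hY k) (hd' k) (St (some k)) (Pr (some k)) (fun j => Or.inr ⟨j, rfl⟩)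
      (fun i => ⟨i, rfl⟩) h
  have crit : ∀ χ : Fin m → ℝ, χ ≠ 0 → ∀ k l,
      (∃ p ∈ fqMoves (St k) (Pr k), 0 < (χ ⬝ᵥ fun i => (π p.1 i : ℝ)) ∧
        0 < (χ ⬝ᵥ fun i => (π p.2 i : ℝ))) ∨
      (∃ p ∈ fqMoves (St l) (Pr l), (χ ⬝ᵥ fun i => (π p.1 i : ℝ)) < 0 ∧
        (χ ⬝ᵥ fun i => (π p.2 i : ℝ)) < 0) := by
    intro χ hχ k l
    rcases k with _ | k
    · exact Or.inl (hmove0 χ hχ)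
    rcases l with _ | l
    · right
      obtain ⟨p, hp, h1, h2⟩ := hmove0 (-χ) (neg_ne_zero.mpr hχ)
      rw [neg_dotProduct] at h1 h2
      exact ⟨p, hp, by linarith, by linarith⟩
    by_contra hcon
    rw [not_or] at hcon
    obtain ⟨hk, hl⟩ := hcon
    have hk' := hnp χ k (fun p hp h => hk ⟨p, hp, h⟩)
    have hl' := hnp (-χ) l (fun p hp h => by
      rw [neg_dotProduct, neg_dotProduct] at h
      exact hl ⟨p, hp, by linarith [h.1], by linarith [h.2]⟩)
    have hkereq : LinearMap.ker (fqL (-χ)) = LinearMap.ker (fqL χ) := by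
      ext u
      rw [LinearMap.mem_ker, LinearMap.mem_ker, fqL_neg, neg_eq_zero]
    apply hχ
    apply fqL_eq_zero
    rcases eq_or_ne k l with rfl | hkl
    · rw [eq_top_iff, ← (hd k).span]
      have hz : ∀ i, fqL χ ((d k).2.1 i) = 0 ∧ fqL χ ((d k).2.2 i) = 0 := by
        intro i
        obtain ⟨a1, a2, a3⟩ := hk'.2 i
        obtain ⟨c1, c2, c3⟩ := hl'.2 i
        simp only [fqL_neg] at c1 c2 c3
        generalize fqL χ ((d k).2.1 i) = u at *
        generalize fqL χ ((d k).2.2 i) = v at *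
        rcases lt_trichotomy u 0 with hu | hu | hu <;>
        rcases lt_trichotomy v 0 with hv | hv | hv <;>
        first
        | exact ⟨hu, hv⟩
        | exact (a1 ⟨by linarith, by linarith⟩).elim
        | exact (a2 ⟨by linarith, by linarith⟩).elim
        | exact (a3 ⟨by linarith, by linarith⟩).elim
        | exact (c1 ⟨by linarith, by linarith⟩).elim
        | exact (c2 ⟨by linarith, by linarith⟩).elim
        | exact (c3 ⟨by linarith, by linarith⟩).elim
      refine sup_le (sup_le hk'.1 ?_) ?_ <;> rw [Submodule.span_le] <;> rintro _ ⟨i, rfl⟩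
      · exact (hz i).1
      · exact (hz i).2
    · obtain ⟨φ, hφ⟩ := fq_nopos_M χ (ω k) (d k) hk'
      obtain ⟨ψ, hψ⟩ := fq_nopos_M (-χ) (ω l) (d l) hl'
      rw [hkereq] at hψ
      rw [eq_top_iff, ← htr k l hkl φ ψ]
      exact sup_le hφ hψ
  obtain ⟨B, hB, hder⟩ := fq_der π hπ (w0 ^ N) hwc Zp hfin St Pr hStf hPrf hκ crit
  have hKmul : ∀ s ∈ K, ∀ q, b' none (q * s) = b' none q := by
    intro s hs q
    show (if q * s ∈ K then (1 : ℝ) else 0) = if q ∈ K then 1 else 0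
    rw [Subgroup.mul_mem_cancel_right K hs]
  refine fq_main (fq_fp_class_two hQ h2) h2 St Pr (w0 ^ N) e B hStf hPrf hB b' ?_ ?_ ?_
    (hder e) ?_
  · rintro (_ | k) s hs q
    · apply hKmul
      rcases hs with hs | ⟨i, rfl⟩
      · have : s ∈ Zp := hSZc ▸ Subgroup.subset_closure hs
        obtain ⟨z, hz, rfl⟩ := this
        exact hKN z hz
      · exact hKM _
    · rcases hs with hs | ⟨i, rfl⟩
      · have : s ∈ H k := hSHc k ▸ Subgroup.subset_closure hs
        obtain ⟨z, hz, hzk, rfl⟩ := this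
        show b k (q * z ^ N) = b k q
        rw [hbz k q _ (pow_mem hz N), fq_lam_pow hlam hz, Pi.smul_apply, hzk]
        simp
      · exact hbd k q i
  · rintro (_ | k) q
    · rw [hKmul _ (hKN w0 hw0)]
      simp [e]
    · show b k (q * w0 ^ N) = ((2 ^ N : ℕ) : ℝ) * b k q
      rw [hbz k q _ hwc, fq_lam_pow hlam hw0, hlw0]
      simp
  · rintro (_ | k) p hp q
    · exact hp.elim
    · obtain ⟨i, rfl⟩ := hp
      exact hbp k q i
  · intro z hz hz1
    by_cases hl : lam z = 0
    · refine ⟨none, fun c hc => hz1 ?_⟩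
      have h1 := congrFun (fq_delta_unip hN (hlN z hz hl) c _ hc) 1
      apply hKT z hz _ hl
      by_contra hzK
      simp [fqDelta, b', hzK] at h1
    · obtain ⟨k, hk⟩ := Function.ne_iff.mp hl
      refine ⟨some k, fun c => fq_delta_scale (s := (2 : ℝ) ^ lam z k) ?_
        (fun q => hbz k q z hz) (hb1 k) c⟩
      intro h
      rw [zpow_eq_one_iff_right₀ (by norm_num) (by norm_num)] at h
      exact hk h

/-- Every finitely generated nilpotent group `Q` of class 2 occurs as the quotient of a
finitely presented group `G` by an abelian normal subgroup `A` containing every nilpotent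
normal subgroup of `G` (so `A` is the Fitting subgroup of `G`). -/
theorem fitting_quotient_of_fg_class_two_nilpotent
    (Q : Type) [Group Q] [Group.IsNilpotent Q] (hfg : Group.FG Q)
    (hclass : Group.nilpotencyClass Q = 2) :
    ∃ (n : ℕ) (rels : Set (FreeGroup (Fin n))), rels.Finite ∧
      ∃ (A : Subgroup (PresentedGroup rels)) (φ : PresentedGroup rels →* Q),
        A.Normal ∧ (∀ a b : A, a * b = b * a) ∧
        (∀ N : Subgroup (PresentedGroup rels), N.Normal → Group.IsNilpotent N → N ≤ A) ∧
        Function.Surjective φ ∧ φ.ker = A := by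
  have h := (Subgroup.upperCentralSeries_eq_top_iff_nilpotencyClass_le (G := Q) (n := 2)).mpr hclass.le
  refine fq_final hfg fun p q => ?_
  have hp : p ∈ Subgroup.upperCentralSeries Q 2 := by rw [h]; trivial
  have h1 := Subgroup.mem_upperCentralSeries_succ_iff.mp hp q
  rwa [Subgroup.upperCentralSeries_one] at h1
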